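/- Let L and L' be ℤ-lattices and let U denote the hyperbolic plane, i.e. the ℤ-lattice ℤ² whose bilinear form has Gram matrix [[0,1],[1,0]]. Then L and L' lie in the same genus if and only if the orthogonal direct sums U ⊕ L and U ⊕ L' are isometric (there is a ℤ-module isomorphism between them matching the bilinear forms). -/

import Mathlib

open TensorProduct

/-- Two bilinear modules are isometric if there is a linear equivalence matching the forms. -/
def BilinIsometric {R M N : Type*} [CommRing R] [AddCommGroup M] [AddCommGroup N]
    [Module R M] [Module R N]
    (B : LinearMap.BilinForm R M) (B' : LinearMap.BilinForm R N) : Prop :=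
  ∃ e : M ≃ₗ[R] N, ∀ x y : M, B' (e x) (e y) = B x y

/-- The hyperbolic plane `U`: the rank-2 ℤ-lattice with Gram matrix `[[0,1],[1,0]]`. -/
def hypU : LinearMap.BilinForm ℤ (ℤ × ℤ) :=
  LinearMap.mk₂ ℤ (fun x y => x.1 * y.2 + x.2 * y.1)
    (by intros; simp; ring) (by intros; simp; ring)
    (by intros; simp; ring) (by intros; simp; ring)

/-- The orthogonal direct sum of two bilinear forms. -/
def prodForm {M N : Type*} [AddCommGroup M] [AddCommGroup N] [Module ℤ M] [Module ℤ N]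
    (B : LinearMap.BilinForm ℤ M) (B' : LinearMap.BilinForm ℤ N) :
    LinearMap.BilinForm ℤ (M × N) :=
  LinearMap.mk₂ ℤ (fun x y => B x.1 y.1 + B' x.2 y.2)
    (by intros; simp; ring) (by intros; simp; ring)
    (by intros; simp; ring) (by intros; simp; ring)

/-- Two ℤ-lattices lie in the same genus if they become isometric over ℝ and over the
`p`-adic integers `ℤ_p` for every prime `p`. -/
def SameGenus {M N : Type*} [AddCommGroup M] [AddCommGroup N] [Module ℤ M] [Module ℤ N]
    (B : LinearMap.BilinForm ℤ M) (B' : LinearMap.BilinForm ℤ N) : Prop :=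
  BilinIsometric (B.baseChange ℝ) (B'.baseChange ℝ) ∧
    ∀ (p : ℕ) [Fact p.Prime],
      BilinIsometric (B.baseChange ℤ_[p]) (B'.baseChange ℤ_[p])

namespace BilinIsometric

variable {R M N P : Type*} [CommRing R] [AddCommGroup M] [AddCommGroup N] [AddCommGroup P]
  [Module R M] [Module R N] [Module R P]
  {B : LinearMap.BilinForm R M} {C : LinearMap.BilinForm R N} {D : LinearMap.BilinForm R P}

theorem symm (h : BilinIsometric B C) : BilinIsometric C B := by
  obtain ⟨e, he⟩ := h
  exact ⟨e.symm, fun x y => by rw [← he]; simp⟩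

theorem trans (h : BilinIsometric B C) (h' : BilinIsometric C D) : BilinIsometric B D := by
  obtain ⟨e, he⟩ := h
  obtain ⟨e', he'⟩ := h'
  exact ⟨e.trans e', fun x y => by simp [he, he']⟩

end BilinIsometric

section HyperbolicCancellation

variable {R P : Type*} [CommRing R] [AddCommGroup P] [Module R P]

/-- The orthogonal complement of a pair of vectors. -/
def pairPerp (G : LinearMap.BilinForm R P) (e f : P) : Submodule R P :=
  LinearMap.ker (G e) ⊓ LinearMap.ker (G f)

theorem mem_pairPerp {G : LinearMap.BilinForm R P} {e f x : P} :
    x ∈ pairPerp G e f ↔ G e x = 0 ∧ G f x = 0 := by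
  simp [pairPerp]

/-- A hyperbolic pair: two isotropic vectors with inner product one. -/
def IsHypPair (G : LinearMap.BilinForm R P) (e f : P) : Prop :=
  G e e = 0 ∧ G f f = 0 ∧ G e f = 1

theorem pairPerp_swap (G : LinearMap.BilinForm R P) (e f : P) :
    pairPerp G e f = pairPerp G f e := inf_comm _ _

theorem pairPerp_smul_unit (G : LinearMap.BilinForm R P) (e f : P) (u : Rˣ) :
    pairPerp G e ((u : R) • f) = pairPerp G e f := by
  ext x
  simp [mem_pairPerp]

/-- The complement of a hyperbolic pair `(e, f)` depends only on `e` up to isometry, being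
isometric to `e^⊥ / e`. -/
theorem pairPerp_isometric_of_left {G : LinearMap.BilinForm R P} (hG : ∀ x y, G x y = G y x)
    {e f f' : P} (h : IsHypPair G e f) (h' : IsHypPair G e f') :
    BilinIsometric (G.restrict (pairPerp G e f)) (G.restrict (pairPerp G e f')) := by
  obtain ⟨hee, -, hef⟩ := h
  obtain ⟨-, -, hef'⟩ := h'
  have hfe : G f e = 1 := by rw [hG, hef]
  have hfe' : G f' e = 1 := by rw [hG, hef']
  let φ : ∀ g g' : P, G e g' = 1 → (pairPerp G e g →ₗ[R] pairPerp G e g') := fun g g' hg' =>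
    LinearMap.codRestrict _
      ((LinearMap.id - (G g').smulRight e).comp (pairPerp G e g).subtype) (by
        rintro ⟨x, hx⟩
        have := mem_pairPerp.1 hx
        rw [mem_pairPerp]
        have hg'' : G g' e = 1 := by rw [hG, hg']
        simp [this.1, hee, hg''])
  refine ⟨LinearEquiv.ofLinearMap (φ f f' hef') (φ f' f hef) ?_ ?_, ?_⟩
  · ext ⟨x, hx⟩
    have := mem_pairPerp.1 hx
    simp [φ, this.2, hfe']
  · ext ⟨x, hx⟩
    have := mem_pairPerp.1 hx
    simp [φ, this.2, hfe]
  · rintro ⟨x, hx⟩ ⟨y, hy⟩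
    have hx := (mem_pairPerp.1 hx).1
    have hy := (mem_pairPerp.1 hy).1
    have hx' : G x e = 0 := by rw [hG, hx]
    simp [φ, hx', hy, hee]

theorem pairPerp_isometric_of_isUnit {G : LinearMap.BilinForm R P} (hG : ∀ x y, G x y = G y x)
    {e f e' f' : P} (h : IsHypPair G e f) (h' : IsHypPair G e' f') (hu : IsUnit (G e e')) :
    BilinIsometric (G.restrict (pairPerp G e f)) (G.restrict (pairPerp G e' f')) := by
  obtain ⟨u, hu⟩ := hu
  have h₁ : IsHypPair G e ((↑u⁻¹ : R) • e') := ⟨h.1, by simp [h'.1], by simp [← hu]⟩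
  have h₂ : IsHypPair G e' ((↑u⁻¹ : R) • e) := ⟨h'.1, by simp [h.1], by simp [hG e' e, ← hu]⟩
  have := pairPerp_isometric_of_left hG h h₁
  rw [pairPerp_smul_unit, pairPerp_swap G e e', ← pairPerp_smul_unit G e' e u⁻¹] at this
  exact this.trans (pairPerp_isometric_of_left hG h₂ h')

/-- Over a local ring, the complements of any two hyperbolic pairs are isometric. -/
theorem pairPerp_isometric [IsLocalRing R] {G : LinearMap.BilinForm R P}
    (hG : ∀ x y, G x y = G y x) {e f e' f' : P} (h : IsHypPair G e f) (h' : IsHypPair G e' f') :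
    BilinIsometric (G.restrict (pairPerp G e f)) (G.restrict (pairPerp G e' f')) := by
  have swap : ∀ {a b : P}, IsHypPair G a b → IsHypPair G b a := fun k =>
    ⟨k.2.1, k.1, by rw [hG]; exact k.2.2⟩
  by_cases h₁ : IsUnit (G e e')
  · exact pairPerp_isometric_of_isUnit hG h h' h₁
  by_cases h₂ : IsUnit (G e f')
  · rw [pairPerp_swap G e' f']
    exact pairPerp_isometric_of_isUnit hG h (swap h') h₂
  by_cases h₃ : IsUnit (G f e')
  · rw [pairPerp_swap G e f]
    exact pairPerp_isometric_of_isUnit hG (swap h) h' h₃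
  have unit_of : ∀ {a : R}, ¬ IsUnit a → IsUnit (1 + a) := fun {a} ha => by
    rcases IsLocalRing.isUnit_or_isUnit_of_add_one (a := -a) (b := 1 + a) (by ring) with k | k
    · exact absurd (by simpa using k) ha
    · exact k
  obtain ⟨s, hs⟩ := unit_of h₂
  let t : R := -(↑s⁻¹ * G f f')
  have hst : (1 + G e f') * t = -G f f' := by
    rw [← hs]; simp [t]
  have fe : G f e = 1 := by rw [hG]; exact h.2.2
  have hpe : G e (f + f' + t • e) = 1 + G e f' := by simp [h.1, h.2.2]
  have hpe' : G e' (f + f' + t • e) = 1 + (G f e' + t * G e e') := by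
    simp [h'.2.2, hG e' f, hG e' e]; ring
  have hw : IsUnit (1 + (G f e' + t * G e e')) := by
    refine unit_of ?_
    have := (IsLocalRing.maximalIdeal R).add_mem
      ((IsLocalRing.mem_maximalIdeal _).2 h₃)
      ((IsLocalRing.maximalIdeal R).mul_mem_left t ((IsLocalRing.mem_maximalIdeal _).2 h₁))
    exact (IsLocalRing.mem_maximalIdeal _).1 this
  have hww : G (f + f' + t • e) (f + f' + t • e) = 0 := by
    simp [h.1, h.2.1, h.2.2, h'.2.1, fe, hG f' f, hG f' e]
    linear_combination 2 * hst
  have hpair : IsHypPair G (f + f' + t • e) ((↑s⁻¹ : R) • e) :=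
    ⟨hww, by simp [h.1], by rw [map_smul, hG, hpe, ← hs]; simp⟩
  refine (pairPerp_isometric_of_isUnit hG h hpair ?_).trans
    (pairPerp_isometric_of_isUnit hG hpair h' ?_)
  · rw [hpe, ← hs]; exact s.isUnit
  · rw [hG, hpe']; exact hw

/-- `B` is isometric to the orthogonal complement of the pair `(e, f)`. -/
def IsPairComplement {K : Type*} [AddCommGroup K] [Module R K] (B : LinearMap.BilinForm R K)
    (G : LinearMap.BilinForm R P) (e f : P) : Prop :=
  BilinIsometric B (G.restrict (pairPerp G e f))

theorem IsPairComplement.isometric [IsLocalRing R] {K K' : Type*} [AddCommGroup K] [Module R K]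
    [AddCommGroup K'] [Module R K'] {B : LinearMap.BilinForm R K} {B' : LinearMap.BilinForm R K'}
    {G : LinearMap.BilinForm R P} (hG : ∀ x y, G x y = G y x) {e f e' f' : P}
    (h : IsHypPair G e f) (h' : IsHypPair G e' f') (hB : IsPairComplement B G e f)
    (hB' : IsPairComplement B' G e' f') : BilinIsometric B B' :=
  (BilinIsometric.trans hB (pairPerp_isometric hG h h')).trans (BilinIsometric.symm hB')

theorem IsPairComplement.map {K Q : Type*} [AddCommGroup K] [Module R K]
    [AddCommGroup Q] [Module R Q] {B : LinearMap.BilinForm R K}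
    {G : LinearMap.BilinForm R P} {G' : LinearMap.BilinForm R Q} {e f : P} (ψ : P ≃ₗ[R] Q)
    (hψ : ∀ x y, G' (ψ x) (ψ y) = G x y) (hB : IsPairComplement B G e f) :
    IsPairComplement B G' (ψ e) (ψ f) := by
  refine BilinIsometric.trans hB ⟨ψ.ofSubmodules _ _ ?_, fun x y => hψ _ _⟩
  ext z
  simp only [Submodule.mem_map, mem_pairPerp]
  constructor
  · rintro ⟨x, hx, rfl⟩
    exact ⟨(hψ _ _).trans hx.1, (hψ _ _).trans hx.2⟩
  · intro hz
    refine ⟨ψ.symm z, ?_, by simp⟩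
    rw [← hψ, ← hψ]
    simpa using hz

theorem isPairComplement_of_section {K : Type*} [AddCommGroup K] [Module R K]
    {B : LinearMap.BilinForm R K} {G : LinearMap.BilinForm R P} {e f : P}
    (i : K →ₗ[R] P) (q : P →ₗ[R] K) (hqi : ∀ x, q (i x) = x) (hei : ∀ x, G e (i x) = 0)
    (hfi : ∀ x, G f (i x) = 0) (hii : ∀ x y, G (i x) (i y) = B x y)
    (hdec : ∀ z, z = G f z • e + G e z • f + i (q z)) : IsPairComplement B G e f := by
  refine ⟨LinearEquiv.ofLinearMap
    (LinearMap.codRestrict _ i fun x => mem_pairPerp.2 ⟨hei x, hfi x⟩)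
    (q.comp (pairPerp G e f).subtype) ?_ ?_, ?_⟩
  · ext ⟨z, hz⟩
    have := mem_pairPerp.1 hz
    have h := hdec z
    rw [this.1, this.2] at h
    simp only [zero_smul, zero_add] at h
    simp [← h]
  · exact LinearMap.ext fun x => hqi x
  · intro x y
    exact hii x y

end HyperbolicCancellation

section BaseChange

variable {M N : Type*} [AddCommGroup M] [AddCommGroup N]

theorem prodForm_isSymm {B : LinearMap.BilinForm ℤ M} (hB : B.IsSymm) :
    (prodForm hypU B).IsSymm := by
  constructor
  rintro ⟨⟨a, b⟩, x⟩ ⟨⟨c, d⟩, y⟩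
  simp [prodForm, hypU, hB.eq x y]
  ring

theorem baseChange_symm_apply (R : Type*) [CommRing R] {P : Type*} [AddCommGroup P]
    {G : LinearMap.BilinForm ℤ P} (hG : G.IsSymm) (x y : R ⊗[ℤ] P) :
    G.baseChange R x y = G.baseChange R y x := by
  induction x using TensorProduct.induction_on with
  | zero => simp
  | add x₁ x₂ h₁ h₂ => simp [h₁, h₂]
  | tmul r x =>
    induction y using TensorProduct.induction_on with
    | zero => simp
    | add y₁ y₂ h₁ h₂ => simp [h₁, h₂]
    | tmul s y => simp [hG.eq x y, mul_comm]

theorem isometric_baseChange_pairPerp (R : Type*) [CommRing R] (B : LinearMap.BilinForm ℤ M) :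
    IsHypPair ((prodForm hypU B).baseChange R)
      ((1 : R) ⊗ₜ[ℤ] (((1, 0), 0) : (ℤ × ℤ) × M)) (1 ⊗ₜ (((0, 1), 0) : (ℤ × ℤ) × M)) ∧
    IsPairComplement (B.baseChange R) ((prodForm hypU B).baseChange R)
      ((1 : R) ⊗ₜ[ℤ] (((1, 0), 0) : (ℤ × ℤ) × M)) (1 ⊗ₜ (((0, 1), 0) : (ℤ × ℤ) × M)) := by
  set G := (prodForm hypU B).baseChange R with hGdef
  set e : R ⊗[ℤ] ((ℤ × ℤ) × M) := (1 : R) ⊗ₜ[ℤ] (((1, 0), 0) : (ℤ × ℤ) × M) with he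
  set f : R ⊗[ℤ] ((ℤ × ℤ) × M) := (1 : R) ⊗ₜ[ℤ] (((0, 1), 0) : (ℤ × ℤ) × M) with hf
  let i : R ⊗[ℤ] M →ₗ[R] R ⊗[ℤ] ((ℤ × ℤ) × M) :=
    (AddMonoidHom.inr (ℤ × ℤ) M).toIntLinearMap.baseChange R
  let q : R ⊗[ℤ] ((ℤ × ℤ) × M) →ₗ[R] R ⊗[ℤ] M :=
    (AddMonoidHom.snd (ℤ × ℤ) M).toIntLinearMap.baseChange R
  have hqi : ∀ x, q (i x) = x := fun x => by
    induction x using TensorProduct.induction_on with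
    | zero => simp
    | add x₁ x₂ h₁ h₂ => simp [h₁, h₂]
    | tmul r x => simp [i, q]
  have hei : ∀ x, G e (i x) = 0 := fun x => by
    induction x using TensorProduct.induction_on with
    | zero => simp
    | add x₁ x₂ h₁ h₂ => simp [h₁, h₂]
    | tmul r x => simp [i, he, hGdef, prodForm, hypU]
  have hfi : ∀ x, G f (i x) = 0 := fun x => by
    induction x using TensorProduct.induction_on with
    | zero => simp
    | add x₁ x₂ h₁ h₂ => simp [h₁, h₂]
    | tmul r x => simp [i, hf, hGdef, prodForm, hypU]
  have hii : ∀ x y, G (i x) (i y) = B.baseChange R x y := fun x y => by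
    induction x using TensorProduct.induction_on with
    | zero => simp
    | add x₁ x₂ h₁ h₂ => simp [h₁, h₂]
    | tmul r x =>
      induction y using TensorProduct.induction_on with
      | zero => simp
      | add y₁ y₂ h₁ h₂ => simp [h₁, h₂]
      | tmul s y => simp [i, hGdef, prodForm, hypU]
  have hdec : ∀ z, z = G f z • e + G e z • f + i (q z) := fun z => by
    induction z using TensorProduct.induction_on with
    | zero => simp
    | add x₁ x₂ h₁ h₂ =>
      nth_rewrite 1 [h₁, h₂]
      simp only [map_add, add_smul]
      abel
    | tmul r z =>
      obtain ⟨⟨a, b⟩, m⟩ := z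
      simp only [hGdef, he, hf, LinearMap.BilinForm.baseChange_tmul, i, q,
        LinearMap.baseChange_tmul, TensorProduct.smul_tmul', prodForm, hypU]
      simp only [LinearMap.mk₂_apply]
      simp only [smul_eq_mul, mul_one, one_mul, zero_mul, add_zero, zero_add,
        map_zero, LinearMap.zero_apply, AddMonoidHom.coe_toIntLinearMap, AddMonoidHom.coe_snd,
        AddMonoidHom.inr_apply]
      rw [TensorProduct.smul_tmul, TensorProduct.smul_tmul, ← TensorProduct.tmul_add,
        ← TensorProduct.tmul_add]
      simp
  refine ⟨⟨?_, ?_, ?_⟩, ?_⟩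
  · simp [he, hGdef, prodForm, hypU]
  · simp [hf, hGdef, prodForm, hypU]
  · simp [he, hf, hGdef, prodForm, hypU]
  · exact isPairComplement_of_section i q hqi hei hfi hii hdec

/-- The hyperbolic plane can be cancelled over a local ring. -/
theorem baseChange_isometric_of_prodForm_hypU (R : Type*) [CommRing R] [IsLocalRing R]
    {B : LinearMap.BilinForm ℤ M} {B' : LinearMap.BilinForm ℤ N}
    (hB' : B'.IsSymm)
    (h : BilinIsometric (prodForm hypU B) (prodForm hypU B')) :
    BilinIsometric (B.baseChange R) (B'.baseChange R) := by
  obtain ⟨φ, hφ⟩ := h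
  obtain ⟨hp, hi⟩ := isometric_baseChange_pairPerp R B
  obtain ⟨hp', hi'⟩ := isometric_baseChange_pairPerp R B'
  let ψ : R ⊗[ℤ] ((ℤ × ℤ) × M) ≃ₗ[R] R ⊗[ℤ] ((ℤ × ℤ) × N) := φ.baseChange ℤ R _ _
  have hψ : ∀ x y, (prodForm hypU B').baseChange R (ψ x) (ψ y) =
      (prodForm hypU B).baseChange R x y := fun x y => by
    induction x using TensorProduct.induction_on with
    | zero => simp
    | add x₁ x₂ h₁ h₂ => simp [h₁, h₂]
    | tmul r x =>
      induction y using TensorProduct.induction_on with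
      | zero => simp
      | add y₁ y₂ h₁ h₂ => simp [h₁, h₂]
      | tmul s y => simp [ψ, hφ]
  set e : R ⊗[ℤ] ((ℤ × ℤ) × M) := (1 : R) ⊗ₜ[ℤ] (((1, 0), 0) : (ℤ × ℤ) × M)
  set f : R ⊗[ℤ] ((ℤ × ℤ) × M) := (1 : R) ⊗ₜ[ℤ] (((0, 1), 0) : (ℤ × ℤ) × M)
  have hpψ : IsHypPair ((prodForm hypU B').baseChange R) (ψ e) (ψ f) := by
    simpa only [IsHypPair, hψ] using hp
  exact IsPairComplement.isometric (baseChange_symm_apply R (prodForm_isSymm hB')) hpψ hp'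
    (hi.map ψ hψ) hi'

theorem sameGenus_of_prodForm_hypU {B : LinearMap.BilinForm ℤ M} {B' : LinearMap.BilinForm ℤ N}
    (hB' : B'.IsSymm)
    (h : BilinIsometric (prodForm hypU B) (prodForm hypU B')) : SameGenus B B' :=
  ⟨baseChange_isometric_of_prodForm_hypU ℝ hB' h,
    fun p _ => baseChange_isometric_of_prodForm_hypU ℤ_[p] hB' h⟩

end BaseChange

section Lagrangian

variable {F : Type*} [Field F] {V W V' : Type*} [AddCommGroup V] [Module F V]
  [AddCommGroup W] [Module F W] [AddCommGroup V'] [Module F V']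

/-- The orthogonal sum of two bilinear forms over a field. -/
def orthSum (B : LinearMap.BilinForm F V) (B' : LinearMap.BilinForm F W) :
    LinearMap.BilinForm F (V × W) :=
  B.compl₁₂ (LinearMap.fst F V W) (LinearMap.fst F V W) +
    B'.compl₁₂ (LinearMap.snd F V W) (LinearMap.snd F V W)

@[simp]
theorem orthSum_apply (B : LinearMap.BilinForm F V) (B' : LinearMap.BilinForm F W) (x y : V × W) :
    orthSum B B' x y = B x.1 y.1 + B' x.2 y.2 := by
  simp [orthSum]

theorem orthSum_isSymm {B : LinearMap.BilinForm F V} {B' : LinearMap.BilinForm F W}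
    (hB : B.IsSymm) (hB' : B'.IsSymm) : (orthSum B B').IsSymm :=
  ⟨fun x y => by simp [hB.eq x.1, hB'.eq x.2]⟩

theorem nondegenerate_of_isSymm {B : LinearMap.BilinForm F V} (hB : B.IsSymm)
    (h : ∀ x, (∀ y, B x y = 0) → x = 0) : B.Nondegenerate :=
  ⟨h, fun y hy => h y fun x => by rw [hB.eq]; exact hy x⟩

theorem orthSum_nondegenerate {B : LinearMap.BilinForm F V} {B' : LinearMap.BilinForm F W}
    (hB : B.IsSymm) (hB' : B'.IsSymm) (h : B.Nondegenerate) (h' : B'.Nondegenerate) :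
    (orthSum B B').Nondegenerate := by
  refine nondegenerate_of_isSymm (orthSum_isSymm hB hB') fun x hx => ?_
  refine Prod.ext (h.1 _ fun y => ?_) (h'.1 _ fun y => ?_)
  · simpa using hx (y, 0)
  · simpa using hx (0, y)

/-- A form is neutral if it has a totally isotropic subspace of at least half the dimension. -/
def IsNeutral (B : LinearMap.BilinForm F V) : Prop :=
  ∃ X : Submodule F V, (∀ x ∈ X, ∀ y ∈ X, B x y = 0) ∧
    Module.finrank F V ≤ 2 * Module.finrank F X

theorem IsNeutral.of_equiv {B : LinearMap.BilinForm F V} {B' : LinearMap.BilinForm F W}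
    (e : V ≃ₗ[F] W) (he : ∀ x y, B' (e x) (e y) = B x y) (h : IsNeutral B) : IsNeutral B' := by
  obtain ⟨X, hX, hd⟩ := h
  refine ⟨X.map e.toLinearMap, ?_, ?_⟩
  · rintro _ ⟨x, hx, rfl⟩ _ ⟨y, hy, rfl⟩
    exact (he x y).trans (hX x hx y hy)
  · rw [← e.finrank_eq]
    exact hd.trans_eq (by rw [← (e.submoduleMap X).finrank_eq])

theorem IsNeutral.finrank_eq_zero {B : LinearMap.BilinForm F V} (h : IsNeutral B)
    (han : ∀ x, B x x = 0 → x = 0) : Module.finrank F V = 0 := by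
  obtain ⟨X, hX, hd⟩ := h
  have : X = ⊥ := (Submodule.eq_bot_iff X).2 fun x hx => han x (hX x hx x hx)
  rw [this, finrank_bot] at hd
  omega

theorem isotropic_span {B : LinearMap.BilinForm F V} {k : ℕ} {v : Fin k → V}
    (h0 : ∀ i j, B (v i) (v j) = 0) :
    ∀ x ∈ Submodule.span F (Set.range v), ∀ y ∈ Submodule.span F (Set.range v), B x y = 0 := by
  intro x hx y hy
  induction hx using Submodule.span_induction with
  | zero => simp
  | add _ _ _ _ h h' => simp [h, h']
  | smul c _ _ h => simp [h]
  | mem x hx =>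
    obtain ⟨i, rfl⟩ := hx
    induction hy using Submodule.span_induction with
    | zero => simp
    | add _ _ _ _ h h' => simp [h, h']
    | smul c _ _ h => simp [h]
    | mem x hx =>
      obtain ⟨j, rfl⟩ := hx
      exact h0 i j

theorem IsNeutral.of_linearIndependent {B : LinearMap.BilinForm F V} {k : ℕ} (v : Fin k → V)
    (hv : LinearIndependent F v) (h0 : ∀ i j, B (v i) (v j) = 0)
    (hk : Module.finrank F V ≤ 2 * k) : IsNeutral B :=
  ⟨Submodule.span F (Set.range v), isotropic_span h0, by
    rwa [finrank_span_eq_card hv, Fintype.card_fin]⟩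

variable [FiniteDimensional F V] [FiniteDimensional F W]

theorem finrank_submodule_prod (X : Submodule F V) (Y : Submodule F W) :
    Module.finrank F (X.prod Y) = Module.finrank F X + Module.finrank F Y := by
  rw [← Module.finrank_prod, ← LinearMap.finrank_range_of_inj
    (f := X.subtype.prodMap Y.subtype) (X.subtype_injective.prodMap Y.subtype_injective),
    LinearMap.range_prodMap, Submodule.range_subtype, Submodule.range_subtype]

theorem IsNeutral.prod {B : LinearMap.BilinForm F V} {B' : LinearMap.BilinForm F W}
    (h : IsNeutral B) (h' : IsNeutral B') : IsNeutral (orthSum B B') := by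
  obtain ⟨X, hX, hd⟩ := h
  obtain ⟨Y, hY, hd'⟩ := h'
  refine ⟨X.prod Y, ?_, ?_⟩
  · rintro x ⟨hx, hx'⟩ y ⟨hy, hy'⟩
    simp [hX _ hx _ hy, hY _ hx' _ hy']
  · rw [Module.finrank_prod, finrank_submodule_prod]
    omega

theorem two_mul_finrank_le_of_isotropic {B : LinearMap.BilinForm F V} (hn : B.Nondegenerate)
    {X : Submodule F V} (hX : ∀ x ∈ X, ∀ y ∈ X, B x y = 0) :
    2 * Module.finrank F X ≤ Module.finrank F V := by
  have h1 : X ≤ B.orthogonal X := fun x hx y hy => hX y hy x hx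
  have h2 := Submodule.finrank_mono h1
  rw [LinearMap.BilinForm.finrank_orthogonal hn] at h2
  have h3 := Submodule.finrank_le X
  omega

/-- Neutral forms can be cancelled from neutral forms. -/
theorem IsNeutral.of_orthSum {B : LinearMap.BilinForm F V} {B' : LinearMap.BilinForm F W}
    (hB : B.IsSymm) (hB' : B'.IsSymm) (hn : B.Nondegenerate) (hn' : B'.Nondegenerate)
    (h : IsNeutral (orthSum B B')) (h' : IsNeutral B') : IsNeutral B := by
  obtain ⟨X, hX, hd⟩ := h
  obtain ⟨Y, hY, hd'⟩ := h'
  set G := orthSum B B' with hG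
  have hGs := orthSum_isSymm hB hB'
  have hGn := orthSum_nondegenerate hB hB' hn hn'
  let C : Submodule F (V × W) := (⊤ : Submodule F V).prod Y
  let Y' : Submodule F (V × W) := (⊥ : Submodule F V).prod Y
  let S := X ⊓ C
  refine ⟨S.map (LinearMap.fst F V W), ?_, ?_⟩
  · rintro _ ⟨x, ⟨hx, -, hxY⟩, rfl⟩ _ ⟨y, ⟨hy, -, hyY⟩, rfl⟩
    have h₁ := hX x hx y hy
    have h₂ := hY _ hxY _ hyY
    simp only [hG, orthSum_apply] at h₁
    simpa [h₂] using h₁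
  · have hC : Module.finrank F C = Module.finrank F V + Module.finrank F Y := by
      rw [finrank_submodule_prod, finrank_top]
    have h1 := Submodule.finrank_sup_add_finrank_inf_eq X C
    have h2 : Module.finrank F ↥(X ⊔ C) ≤ Module.finrank F (V × W) - Module.finrank F ↥(X ⊓ Y') := by
      rw [← LinearMap.BilinForm.finrank_orthogonal hGn]
      refine Submodule.finrank_mono (sup_le ?_ ?_)
      · intro x hx y hy
        exact hX y hy.1 x hx
      · intro x hx y hy
        have h1 : y.1 = 0 := hy.2.1
        have h2 := hY _ hy.2.2 _ hx.2
        change orthSum B B' y x = 0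
        rw [orthSum_apply, h1, h2]
        simp
    have h3 : Module.finrank F ↥(X ⊓ Y') ≤ Module.finrank F (V × W) := Submodule.finrank_le _
    have h4 := ((LinearMap.fst F V W).domRestrict S).finrank_range_add_finrank_ker
    rw [LinearMap.range_domRestrict] at h4
    have h5 : Module.finrank F (LinearMap.ker ((LinearMap.fst F V W).domRestrict S)) ≤
        Module.finrank F ↥(X ⊓ Y') := by
      rw [← LinearMap.finrank_range_of_inj (f := S.subtype.comp (Submodule.subtype _))
        (S.subtype_injective.comp (Submodule.subtype_injective _))]
      refine Submodule.finrank_mono ?_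
      rintro _ ⟨⟨⟨x, hx⟩, hk⟩, rfl⟩
      exact ⟨hx.1, (hk : x.1 = 0), hx.2.2⟩
    rw [Module.finrank_prod] at h2 h3 hd
    have hS : Module.finrank F S = Module.finrank F ↥(X ⊓ C) := rfl
    omega

end Lagrangian

section WittGroup

variable {F : Type*} [Field F] {ι κ : Type} [Fintype ι] [Fintype κ]

/-- The diagonal bilinear form `∑ aᵢ xᵢ yᵢ`. -/
def diagForm (a : ι → F) : LinearMap.BilinForm F (ι → F) :=
  LinearMap.mk₂ F (fun x y => ∑ i, a i * x i * y i)
    (by intros; simp [mul_add, add_mul, Finset.sum_add_distrib])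
    (by intros; simp [Finset.mul_sum]; congr! 1; ring)
    (by intros; simp [mul_add, Finset.sum_add_distrib])
    (by intros; simp [Finset.mul_sum]; congr! 1; ring)

theorem diagForm_apply (a : ι → F) (x y : ι → F) :
    diagForm a x y = ∑ i, a i * x i * y i := rfl

theorem diagForm_isSymm (a : ι → F) : (diagForm a).IsSymm :=
  ⟨fun x y => by simp only [diagForm_apply]; congr! 1; ring⟩

theorem diagForm_nondegenerate (a : ι → F) (ha : ∀ i, a i ≠ 0) : (diagForm a).Nondegenerate := by
  classical
  refine nondegenerate_of_isSymm (diagForm_isSymm a) fun x hx => funext fun i => ?_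
  have := hx (Pi.single i 1)
  simpa [diagForm_apply, Pi.single_apply, ha i] using this

theorem isNeutral_diagForm_sumElim {a : ι → F} {b : κ → F} :
    IsNeutral (diagForm (Sum.elim a b)) ↔ IsNeutral (orthSum (diagForm a) (diagForm b)) :=
  ⟨.of_equiv (LinearEquiv.sumArrowLequivProdArrow ι κ F F) fun x y => by
    simp [diagForm_apply], .of_equiv (LinearEquiv.sumArrowLequivProdArrow ι κ F F).symm fun x y => by
    simp [diagForm_apply]
    rfl⟩

theorem IsNeutral.diagForm_reindex {a : ι → F} {b : κ → F} (e : ι ≃ κ) (h : ∀ i, b (e i) = a i)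
    (ha : IsNeutral (diagForm a)) : IsNeutral (diagForm b) :=
  ha.of_equiv (LinearEquiv.funCongrLeft F F e.symm) fun x y => by
    simp [diagForm_apply, ← h, LinearEquiv.funCongrLeft_apply, LinearMap.funLeft_apply,
      ← e.sum_comp]

/-- The formal sum of a finite family. -/
noncomputable def formalSum {α : Type*} (b : ι → α) : α →₀ ℤ := ∑ i, Finsupp.single (b i) 1

theorem formalSum_sumElim {α : Type*} (b : ι → α) (c : κ → α) :
    formalSum (Sum.elim b c) = formalSum b + formalSum c := by
  simp [formalSum]

theorem exists_equiv_of_formalSum_eq {α : Type*} (b : ι → α) (c : κ → α)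
    (h : formalSum b = formalSum c) : ∃ e : ι ≃ κ, ∀ i, c (e i) = b i := by
  classical
  have key : ∀ u, Nonempty ({i // b i = u} ≃ {j // c j = u}) := fun u => by
    rw [← Fintype.card_eq]
    have := DFunLike.congr_fun h u
    simp only [formalSum, Finsupp.coe_finsetSum, Finset.sum_apply, Finsupp.single_apply,
      Finset.sum_boole] at this
    rw [Fintype.card_subtype, Fintype.card_subtype]
    exact_mod_cast this
  let f := fun u => (key u).some
  refine ⟨(Equiv.sigmaFiberEquiv b).symm.trans ((Equiv.sigmaCongrRight f).trans
    (Equiv.sigmaFiberEquiv c)), fun i => ?_⟩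
  exact (f (b i) ⟨i, rfl⟩).2

variable (F) in
/-- The relations of the Witt group: formal sums of entries of neutral diagonal forms. -/
noncomputable def wittRel : AddSubgroup (Fˣ →₀ ℤ) :=
  AddSubgroup.closure {x | ∃ (ι : Type) (_ : Fintype ι) (b : ι → Fˣ),
    IsNeutral (diagForm fun i => (b i : F)) ∧ x = formalSum b}

variable (F) in
/-- The Witt group of a field, generated by classes of one-dimensional forms. -/
abbrev WittGroup := (Fˣ →₀ ℤ) ⧸ wittRel F

open Classical in
/-- The Witt class of the one-dimensional form with value `a`, and `0` for `a = 0`. -/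
noncomputable def wittClass (a : F) : WittGroup F :=
  if h : a = 0 then 0 else QuotientAddGroup.mk (Finsupp.single (Units.mk0 a h) 1)

@[simp]
theorem wittClass_zero : wittClass (0 : F) = 0 := by simp [wittClass]

theorem sum_wittClass_units (b : ι → Fˣ) :
    ∑ i, wittClass (b i : F) = QuotientAddGroup.mk (s := wittRel F) (formalSum b) := by
  have : ∀ i, wittClass (b i : F) =
      QuotientAddGroup.mk' (wittRel F) (Finsupp.single (b i) 1) := fun i => by simp [wittClass]
  simp only [this, ← map_sum]
  rfl

theorem IsNeutral.sumElim {a : ι → F} {b : κ → F} (ha : IsNeutral (diagForm a))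
    (hb : IsNeutral (diagForm b)) : IsNeutral (diagForm (Sum.elim a b)) :=
  isNeutral_diagForm_sumElim.2 (ha.prod hb)

theorem exists_of_mem_wittRel {x : Fˣ →₀ ℤ} (hx : x ∈ wittRel F) :
    ∃ (ι κ : Type) (_ : Fintype ι) (_ : Fintype κ) (b : ι → Fˣ) (c : κ → Fˣ),
      IsNeutral (diagForm fun i => (b i : F)) ∧ IsNeutral (diagForm fun i => (c i : F)) ∧
        x + formalSum c = formalSum b := by
  have hE : IsNeutral (diagForm fun i : Empty => ((i.elim : Fˣ) : F)) :=
    ⟨⊥, by simp, by simp⟩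
  have hco : ∀ {ι κ : Type} (b : ι → Fˣ) (c : κ → Fˣ), (fun i => ((Sum.elim b c i : Fˣ) : F)) =
      Sum.elim (fun i => (b i : F)) (fun i => (c i : F)) := by
    intros; ext i; cases i <;> rfl
  induction hx using AddSubgroup.closure_induction with
  | mem x hx =>
    obtain ⟨ι, _, b, hb, rfl⟩ := hx
    exact ⟨ι, Empty, _, inferInstance, b, fun i => i.elim, hb, hE, by simp [formalSum]⟩
  | zero => exact ⟨Empty, Empty, inferInstance, inferInstance, fun i => i.elim, fun i => i.elim,
      hE, hE, by simp⟩
  | add x y _ _ hx hy =>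
    obtain ⟨ι, κ, _, _, b, c, hb, hc, h⟩ := hx
    obtain ⟨ι', κ', _, _, b', c', hb', hc', h'⟩ := hy
    refine ⟨ι ⊕ ι', κ ⊕ κ', inferInstance, inferInstance, Sum.elim b b', Sum.elim c c', ?_, ?_, ?_⟩
    · rw [hco]; exact hb.sumElim hb'
    · rw [hco]; exact hc.sumElim hc'
    · rw [formalSum_sumElim, formalSum_sumElim, ← h, ← h']; abel
  | neg x _ hx =>
    obtain ⟨ι, κ, _, _, b, c, hb, hc, h⟩ := hx
    exact ⟨κ, ι, _, _, c, b, hc, hb, by rw [← h]; abel⟩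

theorem sum_wittClass_eq_zero_iff {a : ι → F} (ha : ∀ i, a i ≠ 0) :
    ∑ i, wittClass (a i) = 0 ↔ IsNeutral (diagForm a) := by
  obtain ⟨a, rfl⟩ : ∃ u : ι → Fˣ, a = fun i => (u i : F) :=
    ⟨fun i => Units.mk0 (a i) (ha i), rfl⟩
  rw [sum_wittClass_units, QuotientAddGroup.eq_zero_iff]
  constructor
  · intro h
    obtain ⟨κ, μ, _, _, b, c, hb, hc, h⟩ := exists_of_mem_wittRel h
    rw [← formalSum_sumElim] at h
    obtain ⟨e, he⟩ := exists_equiv_of_formalSum_eq _ _ h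
    refine IsNeutral.of_orthSum (diagForm_isSymm _) (diagForm_isSymm _)
      (diagForm_nondegenerate _ fun i => (a i).ne_zero)
      (diagForm_nondegenerate _ fun i => (c i).ne_zero)
      (isNeutral_diagForm_sumElim.1 (hb.diagForm_reindex e.symm fun i => ?_)) hc
    obtain ⟨i, rfl⟩ := e.surjective i
    rw [Equiv.symm_apply_apply, he]
    cases i <;> rfl
  · intro h
    exact AddSubgroup.subset_closure ⟨ι, _, a, h, rfl⟩

theorem wittClass_add_eq_zero {a b x y : F} (h : a * x ^ 2 + b * y ^ 2 = 0) (hx : x ≠ 0)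
    (hy : y ≠ 0) : wittClass a + wittClass b = 0 := by
  have hab : a = 0 ↔ b = 0 := by
    constructor <;> rintro rfl <;> simpa [hx, hy] using h
  by_cases ha : a = 0
  · simp [ha, hab.1 ha]
  have hb : b ≠ 0 := mt hab.2 ha
  have := (sum_wittClass_eq_zero_iff (a := ![a, b]) (by intro i; fin_cases i <;> simpa)).2
    (.of_linearIndependent (k := 1) (fun _ => ![x, y]) (.of_subsingleton 0 (by simp [hx]))
      (fun _ _ => by simp [diagForm_apply]; linear_combination h) (by simp))
  simpa using this

theorem wittClass_neg (a : F) : wittClass (-a) = -wittClass a :=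
  eq_neg_of_add_eq_zero_left (wittClass_add_eq_zero (x := 1) (y := 1) (by ring) one_ne_zero one_ne_zero)

theorem wittClass_mul_sq (a : F) {b : F} (hb : b ≠ 0) : wittClass (a * b ^ 2) = wittClass a := by
  rw [← sub_eq_zero, sub_eq_add_neg, ← wittClass_neg]
  exact wittClass_add_eq_zero (x := 1) (y := b) (by ring) one_ne_zero hb

theorem wittClass_add (a b : F) :
    wittClass a + wittClass b = wittClass (a + b) + wittClass (a * b * (a + b)) := by
  by_cases ha : a = 0
  · simp [ha]
  by_cases hb : b = 0
  · simp [hb]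
  by_cases hab : a + b = 0
  · rw [eq_neg_of_add_eq_zero_left hab, wittClass_neg]
    simp
  have := (sum_wittClass_eq_zero_iff (a := ![a, b, -(a + b), -(a * b * (a + b))])
    (by intro i; fin_cases i <;> simp [-neg_add_rev, ha, hb, hab])).2
    (.of_linearIndependent (k := 2) ![![1, 1, 1, 0], ![b, -a, 0, 1]] ?_ ?_ (by simp))
  · simp only [Fin.sum_univ_four, Matrix.cons_val, wittClass_neg] at this
    rw [← sub_eq_zero, ← this]
    abel
  · rw [LinearIndependent.pair_iff]
    intro s t h
    have h2 := congr_fun h 2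
    have h3 := congr_fun h 3
    simp at h2 h3
    exact ⟨h2, h3⟩
  · intro i j
    fin_cases i <;> fin_cases j <;> simp [diagForm_apply, Fin.sum_univ_four] <;> ring

variable {K : Type*} [Field K]

theorem IsNeutral.diagForm_map (f : F →+* K) {a : ι → F} (h : IsNeutral (diagForm a)) :
    IsNeutral (diagForm fun i => f (a i)) := by
  classical
  obtain ⟨X, hX, hd⟩ := h
  let v := fun i j => (Module.finBasis F X i : ι → F) j
  let φ : (Fin (Module.finrank F X) → F) →ₗ[F] (ι → F) :=
    X.subtype ∘ₗ (Module.finBasis F X).equivFun.symm.toLinearMap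
  obtain ⟨g, hg⟩ := φ.exists_leftInverse_of_injective (LinearMap.ker_eq_bot.2
    (X.subtype_injective.comp (LinearEquiv.injective _)))
  have hM : (g.toMatrix'.map f) * (φ.toMatrix'.map f) = 1 := by
    rw [← Matrix.map_mul, ← LinearMap.toMatrix'_comp, hg]
    simp
  have hφ : ∀ i, φ (Pi.single i 1) ∈ X := fun i => by simp [φ]
  refine IsNeutral.of_linearIndependent (fun i => (φ.toMatrix'.map f).mulVec (Pi.single i 1)) ?_ ?_ ?_
  · have : LinearIndependent K fun i => (Pi.single i (1 : K) : Fin (Module.finrank F X) → K) := by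
      convert (Pi.basisFun K (Fin (Module.finrank F X))).linearIndependent with i
      simp
    refine this.map' (φ.toMatrix'.map f).mulVecLin (LinearMap.ker_eq_bot.2 ?_)
    refine Function.LeftInverse.injective (g := (g.toMatrix'.map f).mulVecLin) fun x => ?_
    simp [hM]
  · intro i j
    have := congr_arg f (hX _ (hφ i) _ (hφ j))
    rw [diagForm_apply] at this
    rw [diagForm_apply]
    simpa [LinearMap.toMatrix'_apply, Matrix.mulVec_single] using this
  · simpa using hd

/-- Functoriality of Witt groups. -/
noncomputable def wittMap (f : F →+* K) : WittGroup F →+ WittGroup K :=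
  QuotientAddGroup.map _ _ (Finsupp.mapDomain.addMonoidHom (Units.map (f : F →* K))) <| by
    rw [wittRel, AddSubgroup.closure_le]
    rintro _ ⟨ι, _, b, hb, rfl⟩
    refine AddSubgroup.subset_closure ⟨ι, ‹_›, fun i => Units.map (f : F →* K) (b i), ?_, ?_⟩
    · exact hb.diagForm_map f
    · simp [formalSum]

@[simp]
theorem wittMap_wittClass (f : F →+* K) (a : F) : wittMap f (wittClass a) = wittClass (f a) := by
  by_cases ha : a = 0
  · simp [ha]
  · simp only [wittClass, ha, map_eq_zero, dif_neg, not_false_eq_true]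
    have : Units.map (f : F →* K) (Units.mk0 a ha) = Units.mk0 (f a) (by simpa) := by ext; simp
    rw [← this]
    simp [wittMap]

end WittGroup

section Cancellation

universe u

variable {F : Type*} [Field F]

theorem isSymm_restrict {V : Type*} [AddCommGroup V] [Module F V] {B : LinearMap.BilinForm F V}
    (hB : B.IsSymm) (W : Submodule F V) : (B.restrict W).IsSymm :=
  ⟨fun x y => hB.eq x y⟩

theorem isSymm_neg {V : Type*} [AddCommGroup V] [Module F V]
    {B : LinearMap.BilinForm F V} (hB : B.IsSymm) : (-B).IsSymm :=
  ⟨fun x y => by simp [hB.eq x]⟩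

theorem nondegenerate_neg {V : Type*} [AddCommGroup V] [Module F V]
    {B : LinearMap.BilinForm F V} (hB : B.Nondegenerate) : (-B).Nondegenerate :=
  ⟨fun x hx => hB.1 x fun y => by simpa using hx y, fun x hx => hB.2 x fun y => by simpa using hx y⟩

theorem exists_splitting {V : Type u} [AddCommGroup V] [Module F V] [FiniteDimensional F V]
    {B : LinearMap.BilinForm F V} (hB : B.IsSymm) (hn : B.Nondegenerate) {x : V}
    (hx : B x x ≠ 0) : ∃ W : Submodule F V, (B.restrict W).Nondegenerate ∧
      ∃ e : (F × W) ≃ₗ[F] V, ∀ p q, B (e p) (e q) = B x x * p.1 * q.1 + B p.2 q.2 := by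
  let W := B.orthogonal (F ∙ x)
  have hc : IsCompl (F ∙ x) W := LinearMap.BilinForm.isCompl_span_singleton_orthogonal hx
  have hx0 : x ≠ 0 := by rintro rfl; simp at hx
  refine ⟨W, LinearMap.BilinForm.restrict_nondegenerate_orthogonal_spanSingleton B hn hB.isRefl hx,
    ((LinearEquiv.toSpanNonzeroSingleton F V x hx0).prodCongr (LinearEquiv.refl F W)).trans
      (Submodule.prodEquivOfIsCompl _ _ hc), fun p q => ?_⟩
  have h : ∀ w : W, B x w = 0 := fun w => w.2 x (Submodule.mem_span_singleton_self x)
  have h' : ∀ w : W, B w x = 0 := fun w => by rw [hB.eq, h]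
  simp [h, h']
  ring

/-- Two nondegenerate forms of the same rank with the same Witt class are isometric. -/
theorem exists_isometry_of_isNeutral (h2 : (2 : F) ≠ 0) (n : ℕ) :
    ∀ {V V' : Type u} [AddCommGroup V] [Module F V] [FiniteDimensional F V] [AddCommGroup V']
      [Module F V'] [FiniteDimensional F V'] {B : LinearMap.BilinForm F V}
      {B' : LinearMap.BilinForm F V'}, B.IsSymm → B'.IsSymm → B.Nondegenerate → B'.Nondegenerate →
      Module.finrank F V = n → Module.finrank F V' = n → IsNeutral (orthSum B (-B')) →
      BilinIsometric B B' := by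
  induction n with
  | zero =>
    intro V V' _ _ _ _ _ _ B B' _ _ _ _ h h' _
    refine ⟨LinearEquiv.ofFinrankEq _ _ (h.trans h'.symm), fun x y => ?_⟩
    have := Module.finrank_zero_iff.1 h
    rw [Subsingleton.elim x 0]
    simp
  | succ n ih =>
    intro V V' _ _ _ _ _ _ B B' hB hB' hn hn' h h' hX
    have hVn : Nontrivial V := Module.nontrivial_of_finrank_eq_succ h
    have := invertibleOfNonzero h2
    obtain ⟨x, hx⟩ := LinearMap.BilinForm.exists_bilinForm_self_ne_zero (B := B) (by
      rintro rfl
      obtain ⟨v, hv⟩ := exists_ne (0 : V)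
      exact hv (hn.1 v fun y => rfl)) ⟨hB.eq⟩
    obtain ⟨y, hy⟩ : ∃ y, B' y y = B x x := by
      obtain ⟨X, hX, hd⟩ := hX
      let Z : Submodule F (V × V') := (F ∙ x).prod ⊤
      have hx0 : x ≠ 0 := by rintro rfl; simp at hx
      have hZ : Module.finrank F Z = n + 2 := by
        rw [finrank_submodule_prod, finrank_top, finrank_span_singleton hx0, h']
        omega
      have h1 := Submodule.finrank_sup_add_finrank_inf_eq X Z
      have h3 := Submodule.finrank_le (X ⊔ Z)
      rw [Module.finrank_prod, h, h'] at hd h3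
      obtain ⟨⟨v, y⟩, hv, hv0⟩ := Submodule.exists_mem_ne_zero_of_ne_bot (p := X ⊓ Z) (by
        intro hbot
        rw [hbot, finrank_bot] at h1
        omega)
      obtain ⟨c, rfl⟩ := Submodule.mem_span_singleton.1 hv.2.1
      have hiso := hX _ hv.1 _ hv.1
      simp at hiso
      by_cases hc : c = 0
      · subst hc
        have hy0 : y ≠ 0 := by
          rintro rfl; simp at hv0
        have hyy : B' y y = 0 := by simpa using hiso
        obtain ⟨z, hz⟩ : ∃ z, B' y z ≠ 0 := by
          by_contra! hz
          exact hy0 (hn'.1 y hz)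
        refine ⟨z + ((B x x - B' z z) / (2 * B' y z)) • y, ?_⟩
        have := hB'.eq z y
        simp [hyy, this]
        field_simp
        ring
      · refine ⟨c⁻¹ • y, ?_⟩
        have : B' y y = c * (c * B x x) := by linear_combination -hiso
        simp [this, hc]
    obtain ⟨W, hW, e, he⟩ := exists_splitting hB hn hx
    obtain ⟨W', hW', e', he'⟩ := exists_splitting hB' hn' (x := y) (by rwa [hy])
    have hr : Module.finrank F W = n := by
      have := e.finrank_eq
      rw [Module.finrank_prod, Module.finrank_self] at this
      omega
    have hr' : Module.finrank F W' = n := by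
      have := e'.finrank_eq
      rw [Module.finrank_prod, Module.finrank_self] at this
      omega
    let b : LinearMap.BilinForm F F := B x x • LinearMap.mul F F
    have hbs : b.IsSymm := ⟨fun s t => by simp [b, mul_comm]⟩
    have hbn : b.Nondegenerate := nondegenerate_of_isSymm hbs fun s hs => by
      simpa [b, hx] using hs 1
    let E : ((W × W') × (F × F)) ≃ₗ[F] V × V' := (LinearEquiv.prodComm F _ _).trans
      ((LinearEquiv.prodProdProdComm F F F W W').trans (e.prodCongr e'))
    have hE : ∀ p q, orthSum B (-B') (E p) (E q) =
        orthSum (orthSum (B.restrict W) (-B'.restrict W')) (orthSum b (-b)) p q := fun p q => by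
      simp [E, he, he', hy, b]
      ring
    have hbb : IsNeutral (orthSum b (-b)) :=
      .of_linearIndependent (k := 1) (fun _ => (1, 1)) (.of_subsingleton 0 (by simp)) (by simp [b])
        (by simp)
    obtain ⟨g, hg⟩ := ih (isSymm_restrict hB W) (isSymm_restrict hB' W') hW hW' hr hr'
      (IsNeutral.of_orthSum (orthSum_isSymm (isSymm_restrict hB W)
        (isSymm_neg (isSymm_restrict hB' W'))) (orthSum_isSymm hbs (isSymm_neg hbs))
        (orthSum_nondegenerate (isSymm_restrict hB W) (isSymm_neg (isSymm_restrict hB' W')) hW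
          (nondegenerate_neg hW'))
        (orthSum_nondegenerate hbs (isSymm_neg hbs) hbn (nondegenerate_neg hbn))
        (hX.of_equiv E.symm fun x y => by
          rw [← hE, E.apply_symm_apply, E.apply_symm_apply]) hbb)
    refine ⟨e.symm.trans (((LinearEquiv.refl F F).prodCongr g).trans e'), fun v w => ?_⟩
    obtain ⟨v, rfl⟩ := e.surjective v
    obtain ⟨w, rfl⟩ := e.surjective w
    have : B' (g v.2) (g w.2) = B v.2 w.2 := hg v.2 w.2
    simp [he, he', hy, this]

end Cancellation

section RationalWitt

/-- All prime divisors of `n` are smaller than `k` (in particular `n ≠ 0`). -/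
def IsSmoothInt (k : ℕ) (n : ℤ) : Prop := ∀ q : ℕ, q.Prime → (q : ℤ) ∣ n → q < k

theorem IsSmoothInt.ne_zero {k : ℕ} {n : ℤ} (h : IsSmoothInt k n) : n ≠ 0 := by
  rintro rfl
  obtain ⟨q, hq, hp⟩ := Nat.exists_infinite_primes k
  exact absurd (h q hp (dvd_zero _)) (by omega)

theorem IsSmoothInt.mul {k : ℕ} {m n : ℤ} (hm : IsSmoothInt k m) (hn : IsSmoothInt k n) :
    IsSmoothInt k (m * n) := fun q hq h =>
  ((Nat.prime_iff_prime_int.1 hq).dvd_or_dvd h).elim (hm q hq) (hn q hq)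

theorem IsSmoothInt.neg {k : ℕ} {m : ℤ} (hm : IsSmoothInt k m) : IsSmoothInt k (-m) :=
  fun q hq h => hm q hq ((dvd_neg).1 h)

theorem isSmoothInt_of_abs_lt {k : ℕ} {n : ℤ} (h0 : n ≠ 0) (h : |n| < k) : IsSmoothInt k n :=
  fun q _ hd => by
    have := Int.le_of_dvd (abs_pos.2 h0) ((dvd_abs _ _).2 hd)
    omega

theorem IsSmoothInt.mono {k l : ℕ} (hkl : k ≤ l) {m : ℤ} (hm : IsSmoothInt k m) :
    IsSmoothInt l m := fun q hq h => (hm q hq h).trans_le hkl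

theorem IsSmoothInt.of_dvd {k : ℕ} {m n : ℤ} (hn : IsSmoothInt k n) (h : m ∣ n) :
    IsSmoothInt k m := fun q hq hd => hn q hq (hd.trans h)

theorem IsSmoothInt.not_dvd {p : ℕ} (hp : p.Prime) {m : ℤ} (hm : IsSmoothInt p m) :
    ¬ (p : ℤ) ∣ m := fun h => lt_irrefl _ (hm p hp h)

/-- The subgroup of the rational Witt group generated by integers with prime factors below `k`. -/
noncomputable def smoothWitt (k : ℕ) : AddSubgroup (WittGroup ℚ) :=
  AddSubgroup.closure {x | ∃ n : ℤ, IsSmoothInt k n ∧ x = wittClass (n : ℚ)}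

theorem wittClass_mem_smoothWitt {k : ℕ} {n : ℤ} (h : IsSmoothInt k n) :
    wittClass (n : ℚ) ∈ smoothWitt k := AddSubgroup.subset_closure ⟨n, h, rfl⟩

theorem smoothWitt_mono {k l : ℕ} (h : k ≤ l) : smoothWitt k ≤ smoothWitt l :=
  AddSubgroup.closure_mono fun _ ⟨n, hn, hx⟩ => ⟨n, hn.mono h, hx⟩

theorem exists_mem_smoothWitt (x : WittGroup ℚ) : ∃ k, x ∈ smoothWitt k := by
  induction x using QuotientAddGroup.induction_on with | _ x
  induction x using Finsupp.induction_linear with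
  | zero => exact ⟨0, AddSubgroup.zero_mem _⟩
  | add x y hx hy =>
    obtain ⟨k, hk⟩ := hx
    obtain ⟨l, hl⟩ := hy
    exact ⟨max k l, AddSubgroup.add_mem _ (smoothWitt_mono (le_max_left _ _) hk)
      (smoothWitt_mono (le_max_right _ _) hl)⟩
  | single a n =>
    have h1 : ((Finsupp.single a n : ℚˣ →₀ ℤ) : WittGroup ℚ) = n • wittClass (a : ℚ) := by
      have : Finsupp.single a n = n • Finsupp.single a (1 : ℤ) := by simp
      rw [this, QuotientAddGroup.mk_zsmul]
      simp [wittClass]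
    have h2 : wittClass (a : ℚ) = wittClass (((a : ℚ).num * (a : ℚ).den : ℤ) : ℚ) := by
      rw [← wittClass_mul_sq (a : ℚ) (b := (a : ℚ).den) (by simp)]
      congr 1
      push_cast
      have := Rat.mul_den_eq_num (a : ℚ)
      rw [← this]
      ring
    rw [h1, h2]
    refine ⟨((a : ℚ).num * (a : ℚ).den : ℤ).natAbs + 1, AddSubgroup.zsmul_mem _
      (wittClass_mem_smoothWitt (isSmoothInt_of_abs_lt (by simp) ?_)) _⟩
    rw [Int.abs_eq_natAbs]
    push_cast
    omega

variable {p : ℕ}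

theorem wittClass_prime_mul_small (hp : p.Prime) {c n₁ n₂ r : ℤ} (hc : IsSmoothInt p c)
    (h1 : n₁ ≠ 0) (h2 : n₂ ≠ 0) (hr : r ≠ 0) (h1p : |n₁| < p) (h2p : |n₂| < p) (hrp : |r| < p)
    (h : (p : ℤ) ∣ n₁ * n₂ - r) :
    wittClass (p * c * n₁ * n₂ : ℚ) - wittClass (p * c * r : ℚ) ∈ smoothWitt p := by
  obtain ⟨l, hl⟩ := h
  have hp0 : (p : ℚ) ≠ 0 := by exact_mod_cast hp.ne_zero
  have hl' : (n₁ * n₂ : ℚ) = r + p * l := by exact_mod_cast (by linarith : n₁ * n₂ = r + p * l)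
  by_cases hl0 : l = 0
  · have : (p * c * n₁ * n₂ : ℚ) = p * c * r := by
      rw [mul_assoc, hl', hl0]; simp
    rw [this, sub_self]
    exact AddSubgroup.zero_mem _
  have hlp : |l| < p := by
    have : |(p : ℤ) * l| ≤ |n₁| * |n₂| + |r| := by
      rw [← hl, ← abs_mul]
      exact abs_sub _ _
    rw [abs_mul, Nat.abs_cast] at this
    have hpp : (0 : ℤ) < p := by exact_mod_cast hp.pos
    by_contra! hle
    nlinarith [abs_nonneg n₁, abs_nonneg n₂]
  have key := wittClass_add (p * c * r : ℚ) (p * c * (p * l))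
  have e1 : (p * c * r + p * c * (p * l) : ℚ) = p * c * n₁ * n₂ := by
    rw [mul_assoc _ (n₁ : ℚ), hl']; ring
  have e2 : (p * c * r : ℚ) * (p * c * (p * l)) * (p * c * n₁ * n₂) =
      ((c * r * l * n₁ * n₂ : ℤ) : ℚ) * (p ^ 2 * c) ^ 2 := by push_cast; ring
  have e3 : (p * c * (p * l) : ℚ) = ((c * l : ℤ) : ℚ) * p ^ 2 := by push_cast; ring
  have hc0 : (c : ℚ) ≠ 0 := by exact_mod_cast hc.ne_zero
  rw [e1, e2, wittClass_mul_sq _ (by positivity), e3, wittClass_mul_sq _ hp0] at key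
  have : wittClass (p * c * n₁ * n₂ : ℚ) - wittClass (p * c * r : ℚ) =
      wittClass ((c * l : ℤ) : ℚ) - wittClass ((c * r * l * n₁ * n₂ : ℤ) : ℚ) := by
    rw [sub_eq_sub_iff_add_eq_add, ← key]; abel
  rw [this]
  have hls := isSmoothInt_of_abs_lt hl0 hlp
  exact AddSubgroup.sub_mem _ (wittClass_mem_smoothWitt (hc.mul hls))
    (wittClass_mem_smoothWitt ((((hc.mul (isSmoothInt_of_abs_lt hr hrp)).mul hls).mul
      (isSmoothInt_of_abs_lt h1 h1p)).mul (isSmoothInt_of_abs_lt h2 h2p)))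

theorem exists_small_residue (hp : p.Prime) {m : ℤ} (hm : ¬ (p : ℤ) ∣ m) :
    ∃ r : ℤ, 0 < r ∧ r < p ∧ (p : ℤ) ∣ m - r := by
  have hpp : (0 : ℤ) < p := by exact_mod_cast hp.pos
  refine ⟨m % p, lt_of_le_of_ne (Int.emod_nonneg _ hpp.ne') fun h => hm ?_,
    Int.emod_lt_of_pos _ hpp, Int.dvd_self_sub_emod⟩
  exact Int.dvd_of_emod_eq_zero h.symm

theorem wittClass_prime_mul_nat (hp : p.Prime) (m : ℕ) : ∀ (c r : ℤ), IsSmoothInt p c →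
    IsSmoothInt p m → r ≠ 0 → |r| < p → (p : ℤ) ∣ m - r →
    wittClass (p * c * m : ℚ) - wittClass (p * c * r : ℚ) ∈ smoothWitt p := by
  have hp1 : (1 : ℤ) < p := by exact_mod_cast hp.one_lt
  induction m using induction_on_primes with
  | zero => exact fun c r _ h => absurd rfl h.ne_zero
  | one =>
    intro c r hc _ hr hrp h
    simpa using wittClass_prime_mul_small hp hc (n₁ := 1) (n₂ := 1) one_ne_zero one_ne_zero hr
      (by simpa using hp.one_lt) (by simpa using hp.one_lt) hrp (by simpa using h)
  | prime_mul q m hq ih =>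
    intro c r hc hm hr hrp h
    rw [Nat.cast_mul] at hm h
    have hm' := hm.of_dvd (Dvd.intro_left _ rfl)
    have hqp : q < p := hm q hq (Dvd.intro _ rfl)
    have hqs : IsSmoothInt p q := hm.of_dvd (Dvd.intro _ rfl)
    obtain ⟨r', h0, h1, h2⟩ := exists_small_residue hp (hm'.not_dvd hp)
    have a1 := ih (c * q) r' (hc.mul hqs) hm' h0.ne' (by rwa [abs_of_pos h0]) h2
    have a2 := wittClass_prime_mul_small hp hc (n₁ := q) (n₂ := r') (r := r) hqs.ne_zero h0.ne' hr
      (by simpa using hqp) (by rwa [abs_of_pos h0]) hrp (by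
        have : (q * r' - r : ℤ) = (q * m - r) - q * (m - r') := by ring
        rw [this]
        exact dvd_sub h (h2.mul_left _))
    convert AddSubgroup.add_mem _ a1 a2 using 1
    push_cast
    simp only [← mul_assoc]
    abel

theorem wittClass_prime_mul_residue (hp : p.Prime) {m r : ℤ} (hm : IsSmoothInt p m) (hr : r ≠ 0)
    (hrp : |r| < p) (h : (p : ℤ) ∣ m - r) :
    wittClass (p * m : ℚ) - wittClass (p * r : ℚ) ∈ smoothWitt p := by
  have h1 : IsSmoothInt p 1 := isSmoothInt_of_abs_lt one_ne_zero (by simpa using hp.one_lt)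
  obtain ⟨k, rfl | rfl⟩ := m.eq_nat_or_neg
  · simpa using wittClass_prime_mul_nat hp k 1 r h1 hm hr hrp h
  · have := wittClass_prime_mul_nat hp k (-1) (-r) h1.neg (by simpa using hm.neg) (by simpa)
      (by simpa) (by
        rw [show (k - -r : ℤ) = -(-k - r) by ring]
        exact dvd_neg.2 h)
    simpa using this

theorem wittClass_prime_mul_congr (hp : p.Prime) {m n y : ℤ} (hm : IsSmoothInt p m)
    (hn : IsSmoothInt p n) (hy : ¬ (p : ℤ) ∣ y) (h : (p : ℤ) ∣ m - n * y ^ 2) :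
    wittClass (p * m : ℚ) - wittClass (p * n : ℚ) ∈ smoothWitt p := by
  obtain ⟨z, hz0, hzp, hz⟩ := exists_small_residue hp hy
  have hzs : IsSmoothInt p z := isSmoothInt_of_abs_lt hz0.ne' (by rwa [abs_of_pos hz0])
  obtain ⟨r, hr0, hrp, hr⟩ := exists_small_residue hp (hm.not_dvd hp)
  have a1 := wittClass_prime_mul_residue hp hm hr0.ne' (by rwa [abs_of_pos hr0]) hr
  have a2 := wittClass_prime_mul_residue hp (m := n * (z * z)) (hn.mul (hzs.mul hzs)) hr0.ne'
    (by rwa [abs_of_pos hr0]) (by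
      have : n * (z * z) - r = (m - r) - (m - n * y ^ 2) - n * (y + z) * (y - z) := by ring
      rw [this]
      exact dvd_sub (dvd_sub hr h) (hz.mul_left _))
  have e : (p * ((n * (z * z) : ℤ) : ℚ) : ℚ) = (p * n) * z ^ 2 := by push_cast; ring
  rw [e, wittClass_mul_sq _ (by exact_mod_cast hz0.ne')] at a2
  simpa using AddSubgroup.sub_mem _ a1 a2

end RationalWitt

section RationalWittDescent

variable {p : ℕ}

/-- Elements of the rational Witt group whose residue at `p` has rank at most two. -/
def IsWittReduced (p : ℕ) (x : WittGroup ℚ) : Prop :=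
  ∃ a b : ℤ, |a| < p ∧ |b| < p ∧
    x - (wittClass (p * a : ℚ) + wittClass (p * b : ℚ)) ∈ smoothWitt p

theorem exists_ternary_solution (hp : p.Prime) (hp2 : p ≠ 2) {a b c : ℤ} (ha : ¬ (p : ℤ) ∣ a)
    (hb : ¬ (p : ℤ) ∣ b) : ∃ x y : ℤ, (p : ℤ) ∣ a * x ^ 2 + b * y ^ 2 + c := by
  have := Fact.mk hp
  have ha' : (a : ZMod p) ≠ 0 := by rwa [Ne, ZMod.intCast_zmod_eq_zero_iff_dvd]
  have hb' : (b : ZMod p) ≠ 0 := by rwa [Ne, ZMod.intCast_zmod_eq_zero_iff_dvd]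
  obtain ⟨x, y, h⟩ := FiniteField.exists_root_sum_quadratic
    (f := Polynomial.C (a : ZMod p) * Polynomial.X ^ 2)
    (g := Polynomial.C (b : ZMod p) * Polynomial.X ^ 2 + Polynomial.C (c : ZMod p))
    (Polynomial.degree_C_mul_X_pow 2 ha') (by
      rw [Polynomial.degree_add_C (by rw [Polynomial.degree_C_mul_X_pow 2 hb']; norm_num),
        Polynomial.degree_C_mul_X_pow 2 hb']
      rfl) (by
      rw [ZMod.card]
      exact Nat.odd_iff.1 (hp.odd_of_ne_two hp2))
  refine ⟨x.val, y.val, ?_⟩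
  rw [← ZMod.intCast_zmod_eq_zero_iff_dvd]
  simp at h
  push_cast
  simp only [ZMod.natCast_val, ZMod.cast_id', id]
  rw [← h]; ring

theorem isSmoothInt_and_not_dvd (hp : p.Prime) {a : ℤ} (h0 : a ≠ 0) (h : |a| < p) :
    IsSmoothInt p a ∧ ¬ (p : ℤ) ∣ a :=
  ⟨isSmoothInt_of_abs_lt h0 h, (isSmoothInt_of_abs_lt h0 h).not_dvd hp⟩

theorem exists_add_three (hp : p.Prime) (hp2 : p ≠ 2) {a b c : ℤ} (ha : |a| < p) (hb : |b| < p)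
    (hc : |c| < p) : IsWittReduced p
      (wittClass (p * a : ℚ) + wittClass (p * b : ℚ) + wittClass (p * c : ℚ)) := by
  have hpp : (0 : ℤ) < p := by exact_mod_cast hp.pos
  by_cases ha0 : a = 0
  · exact ⟨b, c, hb, hc, by simp [ha0]⟩
  by_cases hb0 : b = 0
  · exact ⟨a, c, ha, hc, by simp [hb0]⟩
  by_cases hc0 : c = 0
  · exact ⟨a, b, ha, hb, by simp [hc0]⟩
  obtain ⟨has, had⟩ := isSmoothInt_and_not_dvd hp ha0 ha
  obtain ⟨hbs, hbd⟩ := isSmoothInt_and_not_dvd hp hb0 hb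
  obtain ⟨hcs, hcd⟩ := isSmoothInt_and_not_dvd hp hc0 hc
  have hpI := Nat.prime_iff_prime_int.1 hp
  have hneg : wittClass (p * c : ℚ) = -wittClass (p * (-c : ℤ) : ℚ) := by
    rw [← wittClass_neg]; simp
  obtain ⟨x, y, hxy⟩ := exists_ternary_solution (c := c) hp hp2 had hbd
  by_cases hx : (p : ℤ) ∣ x
  · have hy : ¬ (p : ℤ) ∣ y := fun hy => hcd <| by
      have := dvd_sub (dvd_sub hxy ((hx.mul_left x).mul_left a)) ((hy.mul_left y).mul_left b)
      ring_nf at this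
      exact this
    have := wittClass_prime_mul_congr hp hcs.neg hbs hy (by
      have : -c - b * y ^ 2 = -(a * x ^ 2 + b * y ^ 2 + c) + a * (x * x) := by ring
      rw [this]
      exact dvd_add (dvd_neg.2 hxy) ((hx.mul_left x).mul_left a))
    refine ⟨a, 0, ha, by simpa using hp.pos, ?_⟩
    rw [hneg]
    convert AddSubgroup.neg_mem _ this using 1
    simp
    abel
  by_cases hy : (p : ℤ) ∣ y
  · have := wittClass_prime_mul_congr hp hcs.neg has hx (by
      have : -c - a * x ^ 2 = -(a * x ^ 2 + b * y ^ 2 + c) + b * (y * y) := by ring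
      rw [this]
      exact dvd_add (dvd_neg.2 hxy) ((hy.mul_left y).mul_left b))
    refine ⟨b, 0, hb, by simpa using hp.pos, ?_⟩
    rw [hneg]
    convert AddSubgroup.neg_mem _ this using 1
    simp
    abel
  have hax : ¬ (p : ℤ) ∣ a * x ^ 2 := fun h => (hpI.dvd_or_dvd h).elim had fun h =>
    hx (hpI.dvd_of_dvd_pow h)
  have hby : ¬ (p : ℤ) ∣ -(b * y ^ 2) := fun h => (hpI.dvd_or_dvd (dvd_neg.1 h)).elim hbd fun h =>
    hy (hpI.dvd_of_dvd_pow h)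
  obtain ⟨A, hA0, hAp, hA⟩ := exists_small_residue hp hax
  obtain ⟨B, hB0, hBp, hB⟩ := exists_small_residue hp hby
  have hAs : IsSmoothInt p A := isSmoothInt_of_abs_lt hA0.ne' (by rwa [abs_of_pos hA0])
  have hBs : IsSmoothInt p (-B) :=
    (isSmoothInt_of_abs_lt hB0.ne' (by rwa [abs_of_pos hB0])).neg
  have hABc : (p : ℤ) ∣ -c - (A + -B) := by
    have : -c - (A + -B) = -(a * x ^ 2 + b * y ^ 2 + c) + (a * x ^ 2 - A) -
      (-(b * y ^ 2) - B) := by ring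
    rw [this]
    exact dvd_sub (dvd_add (dvd_neg.2 hxy) hA) hB
  have hAB0 : A + -B ≠ 0 := fun h => hcd (by rw [h] at hABc; simpa using hABc)
  have hABp : |A + -B| < p := by rw [abs_lt]; constructor <;> linarith
  have hABs := isSmoothInt_of_abs_lt hAB0 hABp
  have hprod := (hAs.mul hBs).mul hABs
  obtain ⟨r, hr0, hrp, hr⟩ := exists_small_residue hp (hprod.not_dvd hp)
  have a1 := wittClass_prime_mul_congr hp hAs has hx (by
    rw [show A - a * x ^ 2 = -(a * x ^ 2 - A) by ring]
    exact dvd_neg.2 hA)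
  have a2 := wittClass_prime_mul_congr hp hBs hbs hy (by convert hB using 1; ring)
  have a3 := wittClass_prime_mul_residue hp hcs.neg hAB0 hABp hABc
  have a4 := wittClass_prime_mul_residue hp hprod hr0.ne' (by rwa [abs_of_pos hr0]) hr
  have hp0 : (p : ℚ) ≠ 0 := by exact_mod_cast hp.ne_zero
  have key := wittClass_add (p * A : ℚ) (p * (-B : ℤ))
  have e1 : (p * A + p * (-B : ℤ) : ℚ) = p * (A + -B : ℤ) := by push_cast; ring
  have e2 : (p * A * (p * (-B : ℤ)) * (p * (A + -B : ℤ)) : ℚ) =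
    p * (A * -B * (A + -B) : ℤ) * p ^ 2 := by push_cast; ring
  rw [e1, e2, wittClass_mul_sq _ hp0] at key
  refine ⟨r, 0, by rwa [abs_of_pos hr0], by simpa using hp.pos, ?_⟩
  have := AddSubgroup.sub_mem _ (AddSubgroup.sub_mem _ a4 a3) (AddSubgroup.add_mem _ a1 a2)
  rw [hneg]
  convert this using 1
  simp only [Int.cast_zero, mul_zero, wittClass_zero, add_zero]
  rw [← sub_eq_zero] at key ⊢
  refine Eq.trans ?_ key
  abel

theorem IsWittReduced.add (hp : p.Prime) (hp2 : p ≠ 2) {x y : WittGroup ℚ}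
    (hx : IsWittReduced p x) (hy : IsWittReduced p y) : IsWittReduced p (x + y) := by
  obtain ⟨a, b, ha, hb, h1⟩ := hx
  obtain ⟨c, d, hc, hd, h2⟩ := hy
  obtain ⟨a', b', ha', hb', h3⟩ := exists_add_three hp hp2 ha hb hc
  obtain ⟨a'', b'', ha'', hb'', h4⟩ := exists_add_three hp hp2 ha' hb' hd
  refine ⟨a'', b'', ha'', hb'', ?_⟩
  convert AddSubgroup.add_mem _ (AddSubgroup.add_mem _ h1 h2) (AddSubgroup.add_mem _ h3 h4) using 1
  abel

theorem isWittReduced_of_mem (hp : p.Prime) {x : WittGroup ℚ} (hx : x ∈ smoothWitt p) :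
    IsWittReduced p x :=
  ⟨0, 0, by simpa using hp.pos, by simpa using hp.pos, by simpa⟩

theorem isSmoothInt_of_not_dvd (hp : p.Prime) {m : ℤ} (h : IsSmoothInt (p + 1) m)
    (hd : ¬ (p : ℤ) ∣ m) : IsSmoothInt p m := fun q hq hqm =>
  lt_of_le_of_ne (Nat.lt_succ_iff.1 (h q hq hqm)) (by rintro rfl; exact hd hqm)

theorem isWittReduced_wittClass (hp : p.Prime) {n : ℤ} (hn : IsSmoothInt (p + 1) n) :
    IsWittReduced p (wittClass (n : ℚ)) := by
  have hp0 : (p : ℚ) ≠ 0 := by exact_mod_cast hp.ne_zero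
  induction h : n.natAbs using Nat.strong_induction_on generalizing n with
  | _ k ih =>
    by_cases hd : (p : ℤ) ∣ n
    · obtain ⟨m, rfl⟩ := hd
      have hm := hn.of_dvd (Dvd.intro_left _ rfl)
      by_cases hd' : (p : ℤ) ∣ m
      · obtain ⟨l, rfl⟩ := hd'
        have hl := hm.of_dvd (Dvd.intro_left _ rfl)
        have e : (((p : ℤ) * (p * l) : ℤ) : ℚ) = l * p ^ 2 := by push_cast; ring
        rw [e, wittClass_mul_sq _ hp0]
        refine ih _ ?_ hl rfl
        rw [← h]
        simp only [Int.natAbs_mul, Int.natAbs_natCast]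
        have h1 := Int.natAbs_pos.2 hl.ne_zero
        have h2 := hp.one_lt
        nlinarith [Nat.mul_le_mul h2.le h1, Nat.mul_pos hp.pos h1]
      · have hms := isSmoothInt_of_not_dvd hp hm hd'
        obtain ⟨r, h0, hr, hrd⟩ := exists_small_residue hp hd'
        refine ⟨r, 0, by rwa [abs_of_pos h0], by simpa using hp.pos, ?_⟩
        simpa using wittClass_prime_mul_residue hp hms h0.ne' (by rwa [abs_of_pos h0]) hrd
    · exact isWittReduced_of_mem hp (wittClass_mem_smoothWitt (isSmoothInt_of_not_dvd hp hn hd))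

theorem isWittReduced_of_mem_succ (hp : p.Prime) (hp2 : p ≠ 2) {x : WittGroup ℚ}
    (hx : x ∈ smoothWitt (p + 1)) : IsWittReduced p x := by
  induction hx using AddSubgroup.closure_induction with
  | mem x hx => obtain ⟨n, hn, rfl⟩ := hx; exact isWittReduced_wittClass hp hn
  | zero => exact isWittReduced_of_mem hp (AddSubgroup.zero_mem _)
  | add _ _ _ _ hx hy => exact hx.add hp hp2 hy
  | neg x _ hx =>
    obtain ⟨a, b, ha, hb, h⟩ := hx
    refine ⟨-a, -b, by simpa, by simpa, ?_⟩
    convert AddSubgroup.neg_mem _ h using 1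
    simp only [Int.cast_neg, mul_neg, wittClass_neg]
    abel

theorem smoothWitt_succ_of_not_prime {k : ℕ} (hk : ¬ k.Prime) : smoothWitt (k + 1) = smoothWitt k :=
  le_antisymm (AddSubgroup.closure_mono fun _ ⟨n, hn, hx⟩ => ⟨n, fun q hq hqn =>
    lt_of_le_of_ne (Nat.lt_succ_iff.1 (hn q hq hqn)) (by rintro rfl; exact hk hq), hx⟩)
    (smoothWitt_mono k.le_succ)

theorem exists_family_of_mem_smoothWitt {k : ℕ} {x : WittGroup ℚ} (hx : x ∈ smoothWitt k) :
    ∃ (ι : Type) (_ : Fintype ι) (u : ι → ℤ), (∀ i, IsSmoothInt k (u i)) ∧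
      x = ∑ i, wittClass (u i : ℚ) := by
  induction hx using AddSubgroup.closure_induction with
  | mem x hx =>
    obtain ⟨n, hn, rfl⟩ := hx
    exact ⟨Unit, inferInstance, fun _ => n, fun _ => hn, by simp⟩
  | zero => exact ⟨Empty, inferInstance, fun i => i.elim, fun i => i.elim, by simp⟩
  | add _ _ _ _ hx hy =>
    obtain ⟨ι, _, u, hu, rfl⟩ := hx
    obtain ⟨κ, _, v, hv, rfl⟩ := hy
    exact ⟨ι ⊕ κ, inferInstance, Sum.elim u v, fun i => by cases i <;> simp [hu, hv], by simp⟩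
  | neg x _ hx =>
    obtain ⟨ι, _, u, hu, rfl⟩ := hx
    exact ⟨ι, inferInstance, fun i => -u i, fun i => (hu i).neg, by simp [wittClass_neg]⟩

end RationalWittDescent

section Residue

variable {p : ℕ} [Fact p.Prime]

theorem PadicInt.toZMod_eq_zero_iff (x : ℤ_[p]) : PadicInt.toZMod x = 0 ↔ (p : ℤ_[p]) ∣ x := by
  rw [← RingHom.mem_ker, PadicInt.ker_toZMod, PadicInt.maximalIdeal_eq_span_p,
    Ideal.mem_span_singleton]

theorem exists_integral_family {σ : Type} [Fintype σ] (X : Submodule ℚ_[p] (σ → ℚ_[p])) :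
    ∃ (d : ℕ) (b : Fin d → σ → ℤ_[p]), Module.finrank ℚ_[p] X ≤ d ∧
      (∀ g : Fin d → ℤ_[p], (fun s => ((∑ i, g i * b i s : ℤ_[p]) : ℚ_[p])) ∈ X) ∧
      ∀ g : Fin d → ℤ_[p], (∀ s, (p : ℤ_[p]) ∣ ∑ i, g i * b i s) → ∀ i, (p : ℤ_[p]) ∣ g i := by
  let c : (σ → ℤ_[p]) →ₗ[ℤ_[p]] (σ → ℚ_[p]) := (Algebra.linearMap ℤ_[p] ℚ_[p]).compLeft σ
  have hc : ∀ v s, c v s = v s := fun v s => rfl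
  let X₀ : Submodule ℤ_[p] (σ → ℤ_[p]) := (X.restrictScalars ℤ_[p]).comap c
  let b := Module.finBasis ℤ_[p] X₀
  have hsum : ∀ g : Fin (Module.finrank ℤ_[p] X₀) → ℤ_[p], ∀ s,
      ((∑ i, g i • b i : X₀) : σ → ℤ_[p]) s = ∑ i, g i * (b i : σ → ℤ_[p]) s := fun g s => by
    simp
  have hp0 : (p : ℚ_[p]) ≠ 0 := by exact_mod_cast (Fact.out : p.Prime).ne_zero
  have hp0' : (p : ℤ_[p]) ≠ 0 := by exact_mod_cast (Fact.out : p.Prime).ne_zero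
  refine ⟨_, fun i => b i, ?_, fun g => ?_, fun g hg => ?_⟩
  · let B := Module.finBasis ℚ_[p] X
    obtain ⟨N, hN⟩ := IsLocalization.exist_integer_multiples_of_finite (nonZeroDivisors ℤ_[p])
      (fun q : Fin (Module.finrank ℚ_[p] X) × σ => (B q.1 : σ → ℚ_[p]) q.2)
    choose v hv using hN
    have hv' : ∀ i, c (fun s => v (i, s)) = (N : ℤ_[p]) • (B i : σ → ℚ_[p]) := fun i => by
      ext s
      exact hv (i, s)
    have hvX : ∀ i, (fun s => v (i, s)) ∈ X₀ := fun i => by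
      change c _ ∈ X
      rw [hv']
      exact (X.restrictScalars ℤ_[p]).smul_mem _ (B i).2
    have hli : LinearIndependent ℤ_[p] fun i => (⟨fun s => v (i, s), hvX i⟩ : X₀) := by
      refine LinearIndependent.of_comp (c ∘ₗ X₀.subtype) ?_
      have h1 : LinearIndependent ℤ_[p] fun i => (B i : σ → ℚ_[p]) :=
        (B.linearIndependent.map' X.subtype X.ker_subtype).restrict_scalars (R := ℤ_[p])
          (fun x y h => Subtype.ext (by simpa [Algebra.smul_def] using h))
      have h2 := h1.map' (LinearMap.lsmul ℤ_[p] (σ → ℚ_[p]) N) (LinearMap.ker_eq_bot.2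
        (smul_right_injective _ (nonZeroDivisors.ne_zero N.2)))
      have h3 : (⇑(c ∘ₗ X₀.subtype) ∘ fun i => (⟨fun s => v (i, s), hvX i⟩ : X₀)) =
          fun i => (N : ℤ_[p]) • (B i : σ → ℚ_[p]) := funext hv'
      rw [h3]
      exact h2
    simpa using hli.fintype_card_le_finrank
  · have h : (fun s => ((∑ i, g i * (b i : σ → ℤ_[p]) s : ℤ_[p]) : ℚ_[p])) =
        c (∑ i, g i • b i : X₀) := by
      ext s
      rw [hc, hsum]
    rw [h]
    exact (∑ i, g i • b i : X₀).2
  · choose t ht using hg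
    have htX : t ∈ X₀ := by
      change c t ∈ X
      have h1 : c (∑ i, g i • b i : X₀) ∈ X := (∑ i, g i • b i : X₀).2
      have h2 : c t = (p : ℚ_[p])⁻¹ • c (∑ i, g i • b i : X₀) := by
        ext s
        rw [Pi.smul_apply, hc, hc, hsum, ht s]
        simp [hp0]
      rw [h2]
      exact X.smul_mem _ h1
    have h3 : (∑ i, g i • b i : X₀) = (p : ℤ_[p]) • ⟨t, htX⟩ := by
      ext s
      rw [hsum, ht s]
      rfl
    intro i
    have h4 : g i = b.repr ((p : ℤ_[p]) • ⟨t, htX⟩) i := by rw [← h3, b.repr_sum_self]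
    rw [map_smul] at h4
    exact ⟨_, h4⟩

/-- A diagonal `p`-adic form whose residue form at `p` is anisotropic and nonzero is not neutral. -/
theorem not_isNeutral_of_residue {ι κ : Type} [Fintype ι] [Fintype κ] [Nonempty κ] (u : ι → ℤ)
    (r : κ → ℤ) (hu : ∀ i, ¬ (p : ℤ) ∣ u i)
    (hr : ∀ z : κ → ZMod p, ∑ j, (r j : ZMod p) * z j ^ 2 = 0 → z = 0) :
    ¬ IsNeutral (diagForm (Sum.elim (fun i => (u i : ℚ_[p])) (fun j => (p * r j : ℚ_[p])))) := by
  rintro ⟨X, hX, hd⟩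
  have hp0' : (p : ℤ_[p]) ≠ 0 := by exact_mod_cast (Fact.out : p.Prime).ne_zero
  obtain ⟨d, b, hXd, hb, hdvd⟩ := exists_integral_family X
  have hiso : ∀ g h : Fin d → ℤ_[p],
      ∑ i, (u i : ℤ_[p]) * (∑ k, g k * b k (Sum.inl i)) * (∑ k, h k * b k (Sum.inl i)) +
        ∑ j, (p * r j : ℤ_[p]) * (∑ k, g k * b k (Sum.inr j)) * (∑ k, h k * b k (Sum.inr j)) = 0 := by
    intro g h
    have := hX _ (hb g) _ (hb h)
    rw [diagForm_apply, Fintype.sum_sum_type] at this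
    simp only [Sum.elim_inl, Sum.elim_inr] at this
    refine PadicInt.ext ?_
    push_cast
    simpa using this
  have hli : LinearIndependent (ZMod p) fun k i => PadicInt.toZMod (b k (Sum.inl i)) := by
    rw [Fintype.linearIndependent_iff]
    intro g hg
    let h : Fin d → ℤ_[p] := fun k => ((g k).val : ℤ_[p])
    have hh : ∀ k, PadicInt.toZMod (h k) = g k := fun k => by simp [h]
    have h1 : ∀ i, (p : ℤ_[p]) ∣ ∑ k, h k * b k (Sum.inl i) := fun i => by
      rw [← PadicInt.toZMod_eq_zero_iff]
      have := congr_fun hg i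
      simpa [hh] using this
    choose t ht using h1
    have h2 := hiso h h
    simp only [ht] at h2
    have h3 : (p : ℤ_[p]) * ∑ i, (u i : ℤ_[p]) * t i * t i +
        ∑ j, (r j : ℤ_[p]) * (∑ k, h k * b k (Sum.inr j)) ^ 2 = 0 := by
      refine mul_left_cancel₀ hp0' ?_
      rw [mul_zero, ← h2, mul_add, Finset.mul_sum, Finset.mul_sum, Finset.mul_sum]
      congr 1 <;> exact Finset.sum_congr rfl fun _ _ => by ring
    have h4 := congr_arg PadicInt.toZMod h3
    simp only [map_add, map_mul, map_natCast, CharP.cast_eq_zero, zero_mul, zero_add, map_sum,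
      map_intCast, map_pow, map_zero] at h4
    have h5 := hr _ h4
    intro k
    rw [← hh, PadicInt.toZMod_eq_zero_iff]
    refine hdvd h (fun s => ?_) k
    cases s with
    | inl i => exact ⟨t i, ht i⟩
    | inr j =>
      rw [← PadicInt.toZMod_eq_zero_iff]
      simpa using congr_fun h5 j
  have hnd : (diagForm fun i => (u i : ZMod p)).Nondegenerate := diagForm_nondegenerate _ fun i => by
    rw [Ne, ZMod.intCast_zmod_eq_zero_iff_dvd]
    exact hu i
  have h6 := two_mul_finrank_le_of_isotropic hnd (isotropic_span (v := fun k i =>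
    PadicInt.toZMod (b k (Sum.inl i))) fun k l => by
      have := congr_arg PadicInt.toZMod (hiso (Pi.single k 1) (Pi.single l 1))
      rw [diagForm_apply]
      simpa [Pi.single_apply] using this)
  rw [finrank_span_eq_card hli] at h6
  have := Fintype.card_pos (α := κ)
  simp at hd h6
  omega

end Residue

section LocalGlobal

variable {p : ℕ} [Fact p.Prime]

theorem wittMap_residue_ne_zero {κ : Type} [Fintype κ] [Nonempty κ]
    (r : κ → ℤ) (hr0 : ∀ j, r j ≠ 0)
    (hr : ∀ z : κ → ZMod p, ∑ j, (r j : ZMod p) * z j ^ 2 = 0 → z = 0) {s : WittGroup ℚ}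
    (hs : s ∈ smoothWitt p) :
    wittMap (algebraMap ℚ ℚ_[p]) (s + ∑ j, wittClass (p * r j : ℚ)) ≠ 0 := by
  obtain ⟨ι, _, u, hu, rfl⟩ := exists_family_of_mem_smoothWitt hs
  intro h
  have hp0 : (p : ℚ_[p]) ≠ 0 := by exact_mod_cast (Fact.out : p.Prime).ne_zero
  refine not_isNeutral_of_residue u r (fun i => (hu i).not_dvd Fact.out) hr
    ((sum_wittClass_eq_zero_iff ?_).1 ?_)
  · rintro (i | j)
    · simpa using (hu i).ne_zero
    · simpa using ⟨(Fact.out : p.Prime).ne_zero, hr0 j⟩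
  · simpa using h

theorem mem_smoothWitt_of_wittMap_eq_zero (hp2 : p ≠ 2) {x : WittGroup ℚ}
    (hx : x ∈ smoothWitt (p + 1)) (h : wittMap (algebraMap ℚ ℚ_[p]) x = 0) :
    x ∈ smoothWitt p := by
  have hp : p.Prime := Fact.out
  obtain ⟨a, b, ha, hb, hs⟩ := isWittReduced_of_mem_succ hp hp2 hx
  have single : ∀ r : ℤ, r ≠ 0 → |r| < p → x - wittClass (p * r : ℚ) ∈ smoothWitt p → False := by
    intro r hr0 hrp hs
    refine wittMap_residue_ne_zero (κ := Unit) (fun _ => r) (fun _ => hr0) (fun z hz => ?_) hs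
      (by simpa using h)
    have hr : (r : ZMod p) ≠ 0 := by
      rw [Ne, ZMod.intCast_zmod_eq_zero_iff_dvd]
      exact (isSmoothInt_and_not_dvd hp hr0 hrp).2
    ext
    simpa [hr] using hz
  by_cases ha0 : a = 0
  · by_cases hb0 : b = 0
    · simpa [ha0, hb0] using hs
    · exact (single b hb0 hb (by simpa [ha0] using hs)).elim
  by_cases hb0 : b = 0
  · exact (single a ha0 ha (by simpa [hb0] using hs)).elim
  obtain ⟨has, had⟩ := isSmoothInt_and_not_dvd hp ha0 ha
  obtain ⟨hbs, hbd⟩ := isSmoothInt_and_not_dvd hp hb0 hb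
  by_cases hy : ∃ y : ℤ, (p : ℤ) ∣ a - -b * y ^ 2
  · obtain ⟨y, hy⟩ := hy
    have hyd : ¬ (p : ℤ) ∣ y := fun hyp => had (by
      have := dvd_add hy ((hyp.mul_left y).mul_left (-b))
      ring_nf at this
      exact this)
    have := wittClass_prime_mul_congr hp has hbs.neg hyd hy
    simpa [wittClass_neg] using AddSubgroup.add_mem _ hs this
  · refine (wittMap_residue_ne_zero (κ := Fin 2) ![a, b] (fun i => by fin_cases i <;> simpa)
      (fun z hz => ?_) hs (by simpa [Fin.sum_univ_two] using h)).elim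
    have ha' : (a : ZMod p) ≠ 0 := by rwa [Ne, ZMod.intCast_zmod_eq_zero_iff_dvd]
    have hb' : (b : ZMod p) ≠ 0 := by rwa [Ne, ZMod.intCast_zmod_eq_zero_iff_dvd]
    simp only [Fin.sum_univ_two, Matrix.cons_val_zero, Matrix.cons_val_one] at hz
    by_cases hz0 : z 0 = 0
    · have hz1 : z 1 = 0 := by simpa [hz0, hb'] using hz
      ext i
      fin_cases i <;> simpa
    · refine (hy ⟨((z 1 / z 0).val : ℤ), ?_⟩).elim
      rw [← ZMod.intCast_zmod_eq_zero_iff_dvd]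
      push_cast
      rw [ZMod.natCast_zmod_val]
      field_simp
      linear_combination hz

theorem wittClass_mem_closure_of_smooth_three {n : ℤ} (hn : IsSmoothInt 3 n) :
    wittClass (n : ℚ) ∈ AddSubgroup.closure {wittClass (1 : ℚ), wittClass (2 : ℚ)} := by
  have hunit : ∀ m : ℤ, IsSmoothInt 3 m → ¬ (2 : ℤ) ∣ m → m = 1 ∨ m = -1 := fun m hm h2 => by
    rw [← Int.natAbs_eq_natAbs_iff (b := 1)]
    by_contra hne
    obtain ⟨q, hq, hqm⟩ := Nat.exists_prime_and_dvd hne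
    have h3 := hm q hq (Int.natCast_dvd.2 hqm)
    have h4 := hq.two_le
    obtain rfl : q = 2 := by omega
    exact h2 (Int.natCast_dvd.2 hqm)
  have h1 : wittClass (1 : ℚ) ∈ AddSubgroup.closure {wittClass (1 : ℚ), wittClass (2 : ℚ)} :=
    AddSubgroup.subset_closure (by simp)
  have h2 : wittClass (2 : ℚ) ∈ AddSubgroup.closure {wittClass (1 : ℚ), wittClass (2 : ℚ)} :=
    AddSubgroup.subset_closure (by simp)
  induction h : n.natAbs using Nat.strong_induction_on generalizing n with
  | _ k ih =>
    by_cases hd : (2 : ℤ) ∣ n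
    · obtain ⟨m, rfl⟩ := hd
      have hm := hn.of_dvd (Dvd.intro_left _ rfl)
      by_cases hd' : (2 : ℤ) ∣ m
      · obtain ⟨l, rfl⟩ := hd'
        have hl := hm.of_dvd (Dvd.intro_left _ rfl)
        have e : (((2 : ℤ) * (2 * l) : ℤ) : ℚ) = l * 2 ^ 2 := by push_cast; ring
        rw [e, wittClass_mul_sq _ two_ne_zero]
        have h1 := hl.ne_zero
        exact ih _ (by omega) hl rfl
      · obtain rfl | rfl := hunit m hm hd'
        · simpa using h2
        · simpa [wittClass_neg] using h2
    · obtain rfl | rfl := hunit n hn hd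
      · simpa using h1
      · simpa [wittClass_neg] using h1

theorem zsmul_wittClass_one_real_eq_zero {n : ℤ} (h : n • wittClass (1 : ℝ) = 0) : n = 0 := by
  have key : ∀ k : ℕ, k • wittClass (1 : ℝ) = 0 → k = 0 := fun k hk => by
    have h1 : ∑ _i : Fin k, wittClass (1 : ℝ) = 0 := by simpa using hk
    have h2 := ((sum_wittClass_eq_zero_iff fun _ => one_ne_zero).1 h1).finrank_eq_zero
      fun x hx => by
        rw [diagForm_apply, Finset.sum_eq_zero_iff_of_nonneg fun i _ => by
          rw [one_mul]; exact mul_self_nonneg _] at hx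
        ext i
        simpa using hx i (Finset.mem_univ _)
    simpa using h2
  obtain ⟨k, rfl | rfl⟩ := n.eq_nat_or_neg
  · simpa using key k (by simpa using h)
  · simpa using key k (by simpa using h)

theorem wittMap_two_sub_one_ne_zero :
    wittMap (algebraMap ℚ ℚ_[3]) (wittClass 2 - wittClass 1) ≠ 0 := by
  intro h
  have h1 : ∑ i, wittClass ((![2, -1] : Fin 2 → ℚ_[3]) i) = 0 := by
    simpa [Fin.sum_univ_two, wittClass_neg, sub_eq_add_neg] using h
  obtain ⟨X, hX, hd⟩ := (sum_wittClass_eq_zero_iff (fun i => by fin_cases i <;> simp)).1 h1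
  have h2 : IsNeutral (diagForm fun i => (3 : ℚ_[3]) * (![2, -1] : Fin 2 → ℚ_[3]) i) := by
    refine ⟨X, fun x hx y hy => ?_, hd⟩
    have := hX x hx y hy
    rw [diagForm_apply] at this ⊢
    simp only [mul_assoc, ← Finset.mul_sum] at this ⊢
    rw [this, mul_zero]
  refine not_isNeutral_of_residue (p := 3) (ι := Empty) (κ := Fin 2) (fun i => i.elim) ![2, -1]
    (fun i => i.elim) (by decide) ?_
  refine h2.diagForm_reindex (Equiv.emptySum Empty (Fin 2)).symm fun i => ?_
  fin_cases i <;> simp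

theorem eq_zero_of_forall_wittMap_eq_zero {x : WittGroup ℚ}
    (hR : wittMap (algebraMap ℚ ℝ) x = 0)
    (hp : ∀ (p : ℕ) [Fact p.Prime], wittMap (algebraMap ℚ ℚ_[p]) x = 0) : x = 0 := by
  obtain ⟨k, hk⟩ := exists_mem_smoothWitt x
  have h3 : x ∈ smoothWitt 3 := by
    suffices h : ∀ m, 3 ≤ m → x ∈ smoothWitt m → x ∈ smoothWitt 3 from
      h _ (le_max_right k 3) (smoothWitt_mono (le_max_left k 3) hk)
    intro m hm
    induction m, hm using Nat.le_induction with
    | base => exact id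
    | succ q hq ih =>
      refine fun this => ih ?_
      by_cases hqp : q.Prime
      · have := Fact.mk hqp
        exact mem_smoothWitt_of_wittMap_eq_zero (by omega) ‹_› (hp q)
      · rwa [smoothWitt_succ_of_not_prime hqp] at this
  have hc : smoothWitt 3 ≤ AddSubgroup.closure {wittClass (1 : ℚ), wittClass (2 : ℚ)} := by
    rw [smoothWitt, AddSubgroup.closure_le]
    rintro _ ⟨n, hn, rfl⟩
    exact wittClass_mem_closure_of_smooth_three hn
  obtain ⟨a, b, rfl⟩ := AddSubgroup.mem_closure_pair.1 (hc h3)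
  have hw2 : wittClass (2 : ℝ) = wittClass 1 := by
    have := wittClass_mul_sq (1 : ℝ) (b := √2) (by simp)
    simpa using this
  have hab : a + b = 0 := zsmul_wittClass_one_real_eq_zero (by
    rw [add_zsmul, ← hR]
    simp [hw2])
  obtain rfl : a = -b := by omega
  have h22 : (2 : ℤ) • (wittClass (2 : ℚ) - wittClass 1) = 0 := by
    have h1 := wittClass_add (2 : ℚ) 2
    have h2 := wittClass_mul_sq (1 : ℚ) (b := 2) two_ne_zero
    have h4 := wittClass_mul_sq (1 : ℚ) (b := 4) (by norm_num)
    norm_num at h1 h2 h4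
    rw [h2, h4] at h1
    rw [zsmul_sub, two_zsmul, two_zsmul, h1, sub_self]
  have hx : -b • wittClass (1 : ℚ) + b • wittClass (2 : ℚ) =
      b • (wittClass (2 : ℚ) - wittClass 1) := by
    rw [neg_smul, zsmul_sub]; abel
  rw [hx]
  rcases Int.even_or_odd' b with ⟨c, rfl | rfl⟩
  · rw [mul_comm, mul_zsmul, h22, zsmul_zero]
  · have h5 : (2 * c + 1) • (wittClass (2 : ℚ) - wittClass 1) = wittClass (2 : ℚ) - wittClass 1 := by
      rw [add_zsmul, mul_comm, mul_zsmul, h22, zsmul_zero, zero_add, one_zsmul]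
    have h6 := hp 3
    rw [hx, h5] at h6
    exact (wittMap_two_sub_one_ne_zero h6).elim

end LocalGlobal

section Neighbors

variable {V : Type*} [AddCommGroup V]

/-- The subgroup `ℤ × ℤ × L` of `ℚ × ℚ × V`. -/
def hypLattice (L : AddSubgroup V) : AddSubgroup (ℚ × ℚ × V) :=
  (Int.castAddHom ℚ).range.prod ((Int.castAddHom ℚ).range.prod L)

theorem mem_hypLattice {L : AddSubgroup V} {x : ℚ × ℚ × V} :
    x ∈ hypLattice L ↔ (∃ a : ℤ, (a : ℚ) = x.1) ∧ (∃ b : ℤ, (b : ℚ) = x.2.1) ∧ x.2.2 ∈ L :=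
  Iff.rfl

/-- Every vector has a nonzero integral multiple in `L`. -/
def IsFull (L : AddSubgroup V) : Prop := ∀ x, ∃ k : ℤ, k ≠ 0 ∧ k • x ∈ L

/-- The localization of `L` away from the integers prime to `p`. -/
def localizedAt (p : ℕ) (L : AddSubgroup V) : Set V := {x | ∃ s : ℤ, ¬ (p : ℤ) ∣ s ∧ s • x ∈ L}

theorem subset_localizedAt {p : ℕ} (hp : p.Prime) (L : AddSubgroup V) :
    (L : Set V) ⊆ localizedAt p L := fun x hx =>
  ⟨1, fun h => hp.one_lt.ne' (by exact_mod_cast Int.eq_one_of_dvd_one (by positivity) h),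
    by simpa using hx⟩

theorem localizedAt_subset_of_forall {p : ℕ} (hp : p.Prime) {L L' : AddSubgroup V}
    (h : (L : Set V) ⊆ localizedAt p L') : localizedAt p L ⊆ localizedAt p L' := by
  rintro x ⟨s, hs, hx⟩
  obtain ⟨t, ht, hx'⟩ := h hx
  exact ⟨t * s, fun hd => (Int.Prime.dvd_mul' hp hd).elim ht hs, by rwa [mul_smul]⟩

theorem localizedAt_subset_of_smul_mem {p : ℕ} (hp : p.Prime) {L L' : AddSubgroup V} {m : ℤ}
    (hm : ¬ (p : ℤ) ∣ m) (h : ∀ x ∈ L, m • x ∈ L') : localizedAt p L ⊆ localizedAt p L' :=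
  localizedAt_subset_of_forall hp fun x hx => ⟨m, hm, h x hx⟩

theorem le_of_forall_localizedAt_subset {L L' : AddSubgroup V}
    (h : ∀ p : ℕ, p.Prime → localizedAt p L ⊆ localizedAt p L') : L ≤ L' := by
  intro x hx
  obtain ⟨d, hd⟩ := (IsPrincipalIdealRing.principal
    (AddSubgroup.toIntSubmodule (L'.comap (zmultiplesHom V x)))).principal
  have key (s : ℤ) : s • x ∈ L' ↔ d ∣ s := by
    rw [← Ideal.mem_span_singleton, ← Ideal.submodule_span_eq, ← hd]
    rfl
  rw [← one_zsmul x, key]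
  by_contra hd1
  obtain ⟨p, hp, hpd⟩ := Nat.exists_prime_and_dvd (n := d.natAbs)
    fun h1 => hd1 (Int.natAbs_dvd_natAbs.1 (by simp [h1]))
  obtain ⟨s, hs, hsx⟩ := h p hp (subset_localizedAt hp L hx)
  exact hs ((Int.natCast_dvd.2 hpd).trans ((key s).1 hsx))

/-- The reflection in the vector `v`; it is the identity if `v` is isotropic. -/
def reflectionMap {K W : Type*} [Field K] [AddCommGroup W] [Module K W]
    (B : LinearMap.BilinForm K W) (v : W) : W →ₗ[K] W :=
  LinearMap.id - (2 / B v v) • (B v).smulRight v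

theorem reflectionMap_apply {K W : Type*} [Field K] [AddCommGroup W] [Module K W]
    (B : LinearMap.BilinForm K W) (v x : W) :
    reflectionMap B v x = x - (2 / B v v * B v x) • v := by
  simp [reflectionMap, mul_smul]

theorem reflectionMap_smul {K W : Type*} [Field K] [AddCommGroup W] [Module K W]
    (B : LinearMap.BilinForm K W) {c : K} (hc : c ≠ 0) (v : W) :
    reflectionMap B (c • v) = reflectionMap B v := by
  ext x
  simp only [reflectionMap_apply, map_smul, LinearMap.smul_apply, smul_eq_mul, smul_smul]
  by_cases h : B v v = 0
  · simp [h]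
  · congr 2
    field_simp

variable [Module ℚ V]

/-- The form of the orthogonal sum of a rational hyperbolic plane and `(V, β)`. -/
def hypSum (β : LinearMap.BilinForm ℚ V) (x y : ℚ × ℚ × V) : ℚ :=
  x.1 * y.2.1 + x.2.1 * y.1 + β x.2.2 y.2.2

/-- `L` and `L'` become isometric after adding a hyperbolic plane. -/
def StablyIsometric (β : LinearMap.BilinForm ℚ V) (L L' : AddSubgroup V) : Prop :=
  ∃ Ψ : (ℚ × ℚ × V) →+ (ℚ × ℚ × V), (∀ x y, hypSum β (Ψ x) (Ψ y) = hypSum β x y) ∧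
    (hypLattice L).map Ψ = hypLattice L'

theorem StablyIsometric.refl (β : LinearMap.BilinForm ℚ V) (L : AddSubgroup V) :
    StablyIsometric β L L :=
  ⟨AddMonoidHom.id _, fun _ _ => rfl, AddSubgroup.map_id _⟩

theorem StablyIsometric.trans {β : LinearMap.BilinForm ℚ V} {L L' L'' : AddSubgroup V}
    (h : StablyIsometric β L L') (h' : StablyIsometric β L' L'') : StablyIsometric β L L'' := by
  obtain ⟨Ψ, h1, h2⟩ := h
  obtain ⟨Ψ', h1', h2'⟩ := h'
  refine ⟨Ψ'.comp Ψ, fun x y => (h1' _ _).trans (h1 x y), ?_⟩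
  rw [← AddSubgroup.map_map, h2, h2']

/-- The form `β` takes integral values on `L`. -/
def IsIntegralOn (β : LinearMap.BilinForm ℚ V) (L : AddSubgroup V) : Prop :=
  ∀ x ∈ L, ∀ y ∈ L, ∃ k : ℤ, (k : ℚ) = β x y

/-- The lattice of the vectors `y - (A / m) v` with `y ∈ L` and `A n ≡ ⟨v, y⟩` modulo `m`. -/
def neighbor (β : LinearMap.BilinForm ℚ V) (L : AddSubgroup V) (v : V) (m n : ℤ) :
    AddSubgroup V where
  carrier := {x | ∃ y ∈ L, ∃ A C : ℤ, x = y - ((A : ℚ) / m) • v ∧ A * n - β v y = m * C}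
  zero_mem' := ⟨0, L.zero_mem, 0, 0, by simp, by simp⟩
  add_mem' := by
    rintro _ _ ⟨y, hy, A, C, rfl, h⟩ ⟨y', hy', A', C', rfl, h'⟩
    refine ⟨y + y', L.add_mem hy hy', A + A', C + C', ?_, ?_⟩
    · push_cast
      rw [add_div, add_smul]
      abel
    · push_cast
      rw [map_add]
      linear_combination h + h'
  neg_mem' := by
    rintro _ ⟨y, hy, A, C, rfl, h⟩
    refine ⟨-y, L.neg_mem hy, -A, -C, ?_, ?_⟩
    · push_cast
      rw [neg_div, neg_smul]
      abel
    · push_cast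
      rw [map_neg]
      linear_combination -h

variable {β : LinearMap.BilinForm ℚ V} {L : AddSubgroup V} {v : V} {m n : ℤ}

theorem mem_neighbor {x : V} : x ∈ neighbor β L v m n ↔
    ∃ y ∈ L, ∃ A C : ℤ, x = y - ((A : ℚ) / m) • v ∧ A * n - β v y = m * C :=
  Iff.rfl

theorem smul_mem_neighbor (hL : IsIntegralOn β L) (hv : v ∈ L) {x : V} (hx : x ∈ L) :
    m • x ∈ neighbor β L v m n := by
  obtain ⟨k, hk⟩ := hL v hv x hx
  refine mem_neighbor.2 ⟨m • x, L.zsmul_mem hx m, 0, -k, by simp, ?_⟩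
  rw [map_zsmul, ← hk]
  simp

theorem smul_mem_of_mem_neighbor (hm : m ≠ 0) (hv : v ∈ L) {x : V}
    (hx : x ∈ neighbor β L v m n) : m • x ∈ L := by
  obtain ⟨y, hy, A, C, rfl, -⟩ := hx
  have : m • (y - ((A : ℚ) / m) • v) = m • y - A • v := by
    rw [smul_sub, ← Int.cast_smul_eq_zsmul ℚ m (((A : ℚ) / m) • v), smul_smul,
      mul_div_cancel₀ _ (Int.cast_ne_zero.2 hm), Int.cast_smul_eq_zsmul]
  rw [this]
  exact L.sub_mem (L.zsmul_mem hy m) (L.zsmul_mem hv A)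

theorem self_mem_neighbor (hv : v ∈ L) (hvv : β v v = 2 * n * m) : v ∈ neighbor β L v m n :=
  mem_neighbor.2 ⟨v, hv, 0, -2 * n, by simp, by rw [hvv]; push_cast; ring⟩

theorem IsFull.neighbor (hL : IsFull L) (hi : IsIntegralOn β L) (hv : v ∈ L) (hm : m ≠ 0) :
    IsFull (neighbor β L v m n) := by
  intro x
  obtain ⟨k, hk, hx⟩ := hL x
  exact ⟨m * k, mul_ne_zero hm hk, by rw [mul_smul]; exact smul_mem_neighbor hi hv hx⟩

theorem IsIntegralOn.neighbor (hβ : β.IsSymm) (hi : IsIntegralOn β L) (hm : m ≠ 0)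
    (hvv : β v v = 2 * n * m) : IsIntegralOn β (neighbor β L v m n) := by
  rintro _ ⟨y, hy, A, C, rfl, h⟩ _ ⟨y', hy', A', C', rfl, h'⟩
  obtain ⟨k, hk⟩ := hi y hy y' hy'
  have hm' : (m : ℚ) ≠ 0 := Int.cast_ne_zero.2 hm
  refine ⟨k + (A * C' + A' * C), ?_⟩
  have e1 : β v y = A * n - m * C := by linear_combination -h
  have e2 : β v y' = A' * n - m * C' := by linear_combination -h'
  simp only [map_sub, map_smul, LinearMap.sub_apply, LinearMap.smul_apply, smul_eq_mul, hvv,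
    hβ.eq y v, e1, e2, ← hk]
  push_cast
  field_simp
  ring

theorem stablyIsometric_neighbor (hβ : β.IsSymm) (hi : IsIntegralOn β L) (hv : v ∈ L)
    (hm : m ≠ 0) (hvv : β v v = 2 * n * m) (hmn : IsCoprime m n) :
    StablyIsometric β L (neighbor β L v m n) := by
  have hm' : (m : ℚ) ≠ 0 := Int.cast_ne_zero.2 hm
  obtain ⟨b, a, hab⟩ := hmn
  have hab' : (b : ℚ) * m + a * n = 1 := by exact_mod_cast hab
  let h : ℚ × ℚ × V → ℚ := fun z => z.2.1 * m - z.1 * n + β v z.2.2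
  let g : ℚ × ℚ × V → ℚ := fun z => -a ^ 2 * n * z.2.1 + b ^ 2 * m * z.1 + a * b * β v z.2.2
  let Ψ : (ℚ × ℚ × V) →+ (ℚ × ℚ × V) := AddMonoidHom.mk'
    (fun z => (g z, h z, z.2.2 - ((z.1 + a * h z) / m) • v)) (by
      rintro ⟨z1, z2, z3⟩ ⟨w1, w2, w3⟩
      simp only [g, h, Prod.mk_add_mk, map_add, Prod.mk.injEq]
      refine ⟨by ring, by ring, ?_⟩
      match_scalars <;> ring)
  have hΨ (z) : Ψ z = (g z, h z, z.2.2 - ((z.1 + a * h z) / m) • v) := rfl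
  refine ⟨Ψ, ?_, le_antisymm ?_ ?_⟩
  · rintro ⟨x1, x2, x3⟩ ⟨y1, y2, y3⟩
    have hb : (b : ℚ) = (1 - a * n) / m := by field_simp; linear_combination hab'
    simp only [hΨ, hypSum, g, h, map_sub, map_smul, LinearMap.sub_apply, LinearMap.smul_apply,
      smul_eq_mul, hvv, hβ.eq x3 v]
    rw [hb]
    field_simp
    ring
  · rintro _ ⟨⟨_, _, y⟩, ⟨⟨x1, rfl⟩, ⟨x2, rfl⟩, hy⟩, rfl⟩
    obtain ⟨k, hk⟩ := hi v hv y hy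
    refine mem_hypLattice.2 ⟨⟨-a ^ 2 * n * x2 + b ^ 2 * m * x1 + a * b * k, ?_⟩,
      ⟨x2 * m - x1 * n + k, ?_⟩, y, hy, x1 + a * (x2 * m - x1 * n + k),
      x2 - b * (x2 * m - x1 * n + k), ?_, ?_⟩
    · simp [hΨ, g, ← hk]
    · simp [hΨ, h, ← hk]
    · simp [hΨ, h, ← hk]
    · rw [← hk]
      push_cast
      linear_combination (x2 * m - x1 * n + k : ℚ) * hab'
  · rintro ⟨_, _, _⟩ ⟨⟨z1, rfl⟩, ⟨z2, rfl⟩, y, hy, A, C, hz, hAC⟩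
    obtain ⟨k, hk⟩ := hi v hv y hy
    obtain rfl := hz
    have hΨe : Ψ (m, -n, v) = (1, 0, 0) := by
      have he : h (m, -n, v) = 0 := by simp only [h, hvv]; ring
      rw [hΨ, he]
      simp only [g, hvv, mul_zero, add_zero, div_self hm', one_smul, sub_self, Prod.mk.injEq,
        and_true]
      linear_combination ((b : ℚ) * m + a * n + 1) * hab'
    let x1 : ℤ := A - a * z2
    let x2 : ℤ := C + b * z2
    let j : ℤ := z1 - (-a ^ 2 * n * x2 + b ^ 2 * m * x1 + a * b * k)
    have hh : h (x1, x2, y) = z2 := by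
      simp only [h, x1, x2]
      push_cast
      linear_combination -hAC + z2 * hab'
    refine ⟨((x1 : ℚ), (x2 : ℚ), y) + j • ((m : ℚ), (-n : ℚ), v), AddSubgroup.add_mem _ ?_
      (AddSubgroup.zsmul_mem _ ?_ j), ?_⟩
    · exact ⟨⟨x1, rfl⟩, ⟨x2, rfl⟩, hy⟩
    · exact ⟨⟨m, rfl⟩, ⟨-n, by simp⟩, hv⟩
    · rw [map_add, map_zsmul, hΨe, hΨ, hh]
      simp only [g, ← hk, Prod.smul_mk, Prod.mk_add_mk, Prod.mk.injEq, smul_zero, add_zero,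
        Int.coe_castAddHom, true_and]
      refine ⟨?_, ?_⟩
      · simp only [j]
        simp
      · simp only [x1]
        push_cast
        simp

theorem localizedAt_neighbor_of_ne {q : ℕ} (hq : q.Prime) (hi : IsIntegralOn β L) (hv : v ∈ L)
    (hm : m ≠ 0) (hqm : ¬ (q : ℤ) ∣ m) :
    localizedAt q (neighbor β L v m n) = localizedAt q L :=
  (localizedAt_subset_of_smul_mem hq hqm fun _ => smul_mem_of_mem_neighbor hm hv).antisymm
    (localizedAt_subset_of_smul_mem hq hqm fun _ => smul_mem_neighbor hi hv)

theorem localizedAt_neighbor {p : ℕ} (hp : p.Prime) (hi : IsIntegralOn β L) (hv : v ∈ L)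
    (hm : m ≠ 0) (hvv : β v v = 2 * n * m) (hmn : IsCoprime m n) (hpn : ¬ (p : ℤ) ∣ n) :
    localizedAt p (neighbor β L v m n) = reflectionMap β v '' localizedAt p L := by
  have hm' : (m : ℚ) ≠ 0 := Int.cast_ne_zero.2 hm
  have hn' : (n : ℚ) ≠ 0 := Int.cast_ne_zero.2 (by rintro rfl; simp at hpn)
  have hr (x) : reflectionMap β v x = x - (β v x / (n * m)) • v := by
    rw [reflectionMap_apply, hvv]
    congr 2
    field_simp
  apply Set.Subset.antisymm
  · rintro x ⟨s, hs, y, hy, A, C, hx, hAC⟩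
    have hs' : (s : ℚ) ≠ 0 := Int.cast_ne_zero.2 (by rintro rfl; simp at hs)
    refine ⟨(s : ℚ)⁻¹ • (y + ((C : ℚ) / n) • v),
      ⟨n * s, fun hd => (Int.Prime.dvd_mul' hp hd).elim hpn hs, ?_⟩, ?_⟩
    · have : (n * s) • ((s : ℚ)⁻¹ • (y + ((C : ℚ) / n) • v)) = n • y + C • v := by
        rw [← Int.cast_smul_eq_zsmul ℚ, ← Int.cast_smul_eq_zsmul ℚ n,
          ← Int.cast_smul_eq_zsmul ℚ C, smul_smul, smul_add, smul_smul]
        push_cast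
        congr 2 <;> field_simp
      rw [this]
      exact L.add_mem (L.zsmul_mem hy n) (L.zsmul_mem hv C)
    · have hx' : x = (s : ℚ)⁻¹ • (y - ((A : ℚ) / m) • v) := by
        rw [← hx, ← Int.cast_smul_eq_zsmul ℚ, inv_smul_smul₀ hs']
      rw [map_smul, hx', hr]
      congr 1
      have e1 : β v y = A * n - m * C := by linear_combination -hAC
      rw [map_add, map_smul, hvv, e1, smul_eq_mul]
      match_scalars
      · ring
      · field_simp
        ring
  · rintro _ ⟨x, ⟨s, hs, hx⟩, rfl⟩
    obtain ⟨k, hk⟩ := hi v hv _ hx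
    obtain ⟨b, a, hab⟩ := hmn
    have hab' : (b : ℚ) * m + a * n = 1 := by exact_mod_cast hab
    refine ⟨n * s, fun hd => (Int.Prime.dvd_mul' hp hd).elim hpn hs, ?_⟩
    have hmem : s • x - (((a * k : ℤ) : ℚ) / m) • v ∈ neighbor β L v m n :=
      ⟨s • x, hx, a * k, -b * k, rfl, by
        rw [← hk]; push_cast; linear_combination (k : ℚ) * hab'⟩
    have : (n * s) • reflectionMap β v x =
        n • (s • x - (((a * k : ℤ) : ℚ) / m) • v) + (-b * k) • v := by
      have hk' : (k : ℚ) = s * β v x := by rw [hk, map_zsmul, zsmul_eq_mul]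
      rw [hr, ← Int.cast_smul_eq_zsmul ℚ, ← Int.cast_smul_eq_zsmul ℚ n,
        ← Int.cast_smul_eq_zsmul ℚ s, ← Int.cast_smul_eq_zsmul ℚ (-b * k)]
      push_cast
      rw [hk', mul_smul]
      match_scalars
      · ring
      · field_simp
        linear_combination (s * β v x : ℚ) * hab'
    rw [this]
    exact AddSubgroup.add_mem _ (AddSubgroup.zsmul_mem _ hmem n)
      (AddSubgroup.zsmul_mem _ (self_mem_neighbor hv hvv) _)

theorem exists_neighbor_reflection (hβ : β.IsSymm) {p : ℕ} (hp : p.Prime) (hi : IsIntegralOn β L)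
    (hL : IsFull L) (v : V) : ∃ L' : AddSubgroup V, IsIntegralOn β L' ∧ IsFull L' ∧
      StablyIsometric β L L' ∧ localizedAt p L' = reflectionMap β v '' localizedAt p L ∧
      ∀ q : ℕ, q.Prime → q ≠ p → localizedAt q L' = localizedAt q L := by
  by_cases hv0 : β v v = 0
  · refine ⟨L, hi, hL, StablyIsometric.refl β L, ?_, fun _ _ _ => rfl⟩
    have : (reflectionMap β v : V → V) = id := funext fun x => by simp [reflectionMap_apply, hv0]
    rw [this, Set.image_id]
  obtain ⟨k, hk, hkv⟩ := hL v
  obtain ⟨N, hN⟩ := hi _ hkv _ hkv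
  have hk' : (k : ℚ) ≠ 0 := Int.cast_ne_zero.2 hk
  have hN0 : N ≠ 0 := by
    rintro rfl
    simp [← Int.cast_smul_eq_zsmul ℚ, hk, hv0] at hN
  obtain ⟨n, hNn, hpn⟩ := (Int.finiteMultiplicity_iff.2
    ⟨by simpa using hp.one_lt.ne', mul_ne_zero two_ne_zero hN0⟩ :
      FiniteMultiplicity (p : ℤ) (2 * N)).exists_eq_pow_mul_and_not_dvd
  generalize multiplicity (p : ℤ) (2 * N) = t at hNn
  have hw : (2 * k) • v ∈ L := by
    rw [mul_smul]
    exact L.zsmul_mem hkv 2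
  have hm : (p : ℤ) ^ t ≠ 0 := pow_ne_zero _ (by exact_mod_cast hp.ne_zero)
  have hww : β ((2 * k) • v) ((2 * k) • v) = 2 * n * ((p ^ t : ℤ) : ℚ) := by
    have h1 : (2 * N : ℚ) = ((p ^ t : ℤ) : ℚ) * n := by exact_mod_cast hNn
    rw [mul_smul, two_zsmul]
    simp only [map_add, LinearMap.add_apply, ← hN]
    linear_combination 2 * h1
  have hcop : IsCoprime ((p : ℤ) ^ t) n :=
    ((Nat.prime_iff_prime_int.1 hp).coprime_iff_not_dvd.2 hpn).pow_left
  have hrefl : reflectionMap β ((2 * k) • v) = reflectionMap β v := by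
    rw [← Int.cast_smul_eq_zsmul ℚ]
    exact reflectionMap_smul β (by push_cast; exact mul_ne_zero two_ne_zero hk') v
  refine ⟨neighbor β L ((2 * k) • v) (p ^ t) n, hi.neighbor hβ hm hww,
    hL.neighbor hi hw hm, stablyIsometric_neighbor hβ hi hw hm hww hcop, ?_, ?_⟩
  · rw [localizedAt_neighbor hp hi hw hm hww hcop hpn, hrefl]
  · intro q hq hqp
    refine localizedAt_neighbor_of_ne hq hi hw hm fun h => hqp ?_
    have := Int.Prime.dvd_pow' hq h
    exact (Nat.prime_dvd_prime_iff_eq hq hp).1 (by exact_mod_cast this)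

theorem exists_neighbor_of_mem_closure (hβ : β.IsSymm) {p : ℕ} (hp : p.Prime)
    {s : Module.End ℚ V} (hs : s ∈ Submonoid.closure (Set.range (reflectionMap β))) :
    ∀ L : AddSubgroup V, IsIntegralOn β L → IsFull L → ∃ L' : AddSubgroup V, IsIntegralOn β L' ∧
      IsFull L' ∧ StablyIsometric β L L' ∧ localizedAt p L' = s '' localizedAt p L ∧
      ∀ q : ℕ, q.Prime → q ≠ p → localizedAt q L' = localizedAt q L := by
  induction hs using Submonoid.closure_induction with
  | mem s hs =>
    obtain ⟨v, rfl⟩ := hs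
    exact fun L hi hL => exists_neighbor_reflection hβ hp hi hL v
  | one =>
    exact fun L hi hL => ⟨L, hi, hL, StablyIsometric.refl β L, by simp, fun _ _ _ => rfl⟩
  | mul s t _ _ ihs iht =>
    intro L hi hL
    obtain ⟨L₁, hi₁, hL₁, h₁, hp₁, hq₁⟩ := iht L hi hL
    obtain ⟨L₂, hi₂, hL₂, h₂, hp₂, hq₂⟩ := ihs L₁ hi₁ hL₁
    refine ⟨L₂, hi₂, hL₂, h₁.trans h₂, ?_, fun q hq hqp => (hq₂ q hq hqp).trans (hq₁ q hq hqp)⟩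
    rw [hp₂, hp₁, Set.image_image]
    rfl

theorem stablyIsometric_of_localizedAt (hβ : β.IsSymm) {L' : AddSubgroup V} (S : Finset ℕ) :
    ∀ L : AddSubgroup V, IsIntegralOn β L → IsFull L →
      (∀ q : ℕ, q.Prime → q ∉ S → localizedAt q L = localizedAt q L') →
      (∀ p : ℕ, p.Prime → ∃ s ∈ Submonoid.closure (Set.range (reflectionMap β)),
        (s : V → V) '' localizedAt p L = localizedAt p L') → StablyIsometric β L L' := by
  induction S using Finset.induction with
  | empty =>
    intro L _ _ h _
    have : L = L' := (le_of_forall_localizedAt_subset fun p hp => (h p hp (by simp)).le).antisymm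
      (le_of_forall_localizedAt_subset fun p hp => (h p hp (by simp)).ge)
    rw [this]
    exact StablyIsometric.refl β L'
  | insert p S hpS ih =>
    intro L hi hL hS hs
    by_cases hp : p.Prime
    · obtain ⟨s, hs1, hs2⟩ := hs p hp
      obtain ⟨L₁, hi₁, hL₁, h₁, hp₁, hq₁⟩ := exists_neighbor_of_mem_closure hβ hp hs1 L hi hL
      refine h₁.trans (ih L₁ hi₁ hL₁ (fun q hq hqS => ?_) fun q hq => ?_)
      · by_cases hqp : q = p
        · rw [hqp, hp₁, hs2]
        · rw [hq₁ q hq hqp, hS q hq (by simp [hqp, hqS])]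
      · by_cases hqp : q = p
        · exact ⟨1, one_mem _, by simp [hqp, hp₁, hs2]⟩
        · rw [hq₁ q hq hqp]
          exact hs q hq
    · refine ih L hi hL (fun q hq hqS => hS q hq ?_) hs
      rw [Finset.mem_insert, not_or]
      exact ⟨fun h => hp (h ▸ hq), hqS⟩

end Neighbors

section CartanDieudonne

variable {K V : Type*} [Field K] [AddCommGroup V] [Module K V] {B : LinearMap.BilinForm K V}

theorem reflectionMap_isometry (hB : B.IsSymm) (v x y : V) :
    B (reflectionMap B v x) (reflectionMap B v y) = B x y := by
  simp only [reflectionMap_apply, map_sub, map_smul, LinearMap.sub_apply, LinearMap.smul_apply,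
    smul_eq_mul, hB.eq x v]
  by_cases hv : B v v = 0
  · simp [hv]
  · field_simp
    ring

theorem reflectionMap_mul_self (v : V) : reflectionMap B v * reflectionMap B v = 1 := by
  ext x
  simp only [Module.End.mul_apply, Module.End.one_apply, reflectionMap_apply, map_sub, map_smul]
  by_cases hv : B v v = 0
  · simp [hv]
  · match_scalars
    · ring
    · field_simp
      ring

theorem reflectionMap_apply_of_eq_zero {v x : V} (h : B v x = 0) : reflectionMap B v x = x := by
  simp [reflectionMap_apply, h]

theorem reflectionMap_sub_apply (h2 : (2 : K) ≠ 0) (hB : B.IsSymm) {x y : V}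
    (hxy : B y y = B x x) (h : B (y - x) (y - x) ≠ 0) : reflectionMap B (y - x) y = x := by
  have h1 : B (y - x) (y - x) = 2 * B (y - x) y := by
    simp only [map_sub, LinearMap.sub_apply, hB.eq x y, hxy]
    ring
  have h3 : B (y - x) y ≠ 0 := right_ne_zero_of_mul (h1 ▸ h)
  rw [reflectionMap_apply, h1, show 2 / (2 * B (y - x) y) * B (y - x) y = 1 by field_simp]
  simp

theorem mem_closure_reflectionMap {ι : Type*} [Finite ι] (h2 : (2 : K) ≠ 0) (hB : B.IsSymm)
    (b : Module.Basis ι K V) (hb : ∀ i j, i ≠ j → B (b i) (b j) = 0)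
    (hb' : ∀ i, B (b i) (b i) ≠ 0) {σ : Module.End K V} (hσ : ∀ x y, B (σ x) (σ y) = B x y) :
    σ ∈ Submonoid.closure (Set.range (reflectionMap B)) := by
  classical
  have := Fintype.ofFinite ι
  suffices h : ∀ (s : Finset ι) (σ : Module.End K V), (∀ x y, B (σ x) (σ y) = B x y) →
      (∀ j ∉ s, σ (b j) = b j) → σ ∈ Submonoid.closure (Set.range (reflectionMap B)) from
    h Finset.univ σ hσ (by simp)
  have hmul {v : V} {ρ : Module.End K V}
      (h : reflectionMap B v * ρ ∈ Submonoid.closure (Set.range (reflectionMap B))) :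
      ρ ∈ Submonoid.closure (Set.range (reflectionMap B)) := by
    have := mul_mem (Submonoid.subset_closure (Set.mem_range_self v)) h
    rwa [← mul_assoc, reflectionMap_mul_self, one_mul] at this
  intro s
  induction s using Finset.induction with
  | empty =>
    intro σ _ h
    have : σ = 1 := b.ext fun j => by simpa using h j (by simp)
    exact this ▸ one_mem _
  | insert i s _ ih =>
    intro σ hσ hfix
    have hij {j} (hj : j ∉ insert i s) : B (σ (b i)) (b j) = 0 ∧ B (b i) (b j) = 0 := by
      have hne : i ≠ j := by rintro rfl; simp at hj
      refine ⟨?_, hb i j hne⟩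
      rw [← hfix j hj, hσ, hb i j hne]
    by_cases h1 : B (σ (b i) - b i) (σ (b i) - b i) = 0
    · have h3 : B (σ (b i) - -b i) (σ (b i) - -b i) ≠ 0 := by
        intro h3
        have : 2 * (2 * B (b i) (b i)) = 0 := by
          simp only [map_sub, map_neg, LinearMap.sub_apply, LinearMap.neg_apply, hσ] at h1 h3
          linear_combination h1 + h3
        simp [h2, hb'] at this
      refine hmul (v := σ (b i) - -b i) (hmul (v := b i) (ih _ (fun x y => ?_) fun j hj => ?_))
      · simp only [Module.End.mul_apply, reflectionMap_isometry hB, hσ]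
      · simp only [Module.End.mul_apply]
        by_cases hji : j = i
        · rw [hji, reflectionMap_sub_apply h2 hB (by simp [hσ]) h3, map_neg, reflectionMap_apply,
            div_mul_cancel₀ _ (hb' i), two_smul]
          simp
        · have hj' : j ∉ insert i s := by simp [hji, hj]
          obtain ⟨h5, h6⟩ := hij hj'
          rw [hfix j hj', reflectionMap_apply_of_eq_zero (v := σ (b i) - -b i) (by simp [h5, h6]),
            reflectionMap_apply_of_eq_zero h6]
    · refine hmul (v := σ (b i) - b i) (ih _ (fun x y => ?_) fun j hj => ?_)
      · simp only [Module.End.mul_apply, reflectionMap_isometry hB, hσ]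
      · simp only [Module.End.mul_apply]
        by_cases hji : j = i
        · rw [hji, reflectionMap_sub_apply h2 hB (hσ _ _) h1]
        · have hj' : j ∉ insert i s := by simp [hji, hj]
          obtain ⟨h5, h6⟩ := hij hj'
          rw [hfix j hj', reflectionMap_apply_of_eq_zero (by simp [h5, h6])]

end CartanDieudonne

section Approximation

open Matrix

variable {ι : Type} [Fintype ι] [DecidableEq ι]

theorem isSymm_toBilin' {R : Type*} [CommRing R] {A : Matrix ι ι R} (hA : A.IsSymm) :
    (toBilin' A).IsSymm := Matrix.isSymm_toBilin'_iff_isSymm.2 hA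

theorem toBilin'_mulVec {R : Type*} [CommRing R] (A T : Matrix ι ι R) (x y : ι → R) :
    toBilin' A (T *ᵥ x) (T *ᵥ y) = toBilin' (Tᵀ * A * T) x y := by
  simp only [toBilin'_apply', dotProduct_mulVec, vecMul_mulVec, ← mulVec_mulVec, mul_assoc,
    vecMul_vecMul, vecMul_transpose]

theorem transpose_mul_mul_eq_of_isometry {R : Type*} [CommRing R] {A A' T : Matrix ι ι R}
    (h : ∀ x y, toBilin' A (T *ᵥ x) (T *ᵥ y) = toBilin' A' x y) : Tᵀ * A * T = A' := by
  refine toBilin'.injective (LinearMap.ext₂ fun x y => ?_)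
  rw [← toBilin'_mulVec, h]

theorem transpose_mul_mul_eq_of_mem_closure {K : Type} [Field K] {A X : Matrix ι ι K}
    (hA : A.IsSymm)
    (hX : toLin' X ∈ Submonoid.closure (Set.range (reflectionMap (toBilin' A)))) :
    Xᵀ * A * X = A := by
  have key : ∀ s ∈ Submonoid.closure (Set.range (reflectionMap (toBilin' A))), ∀ x y,
      toBilin' A (s x) (s y) = toBilin' A x y := by
    intro s hs
    induction hs using Submonoid.closure_induction with
    | mem s hs =>
      obtain ⟨v, rfl⟩ := hs
      exact reflectionMap_isometry (isSymm_toBilin' hA) v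
    | one => simp
    | mul s t _ _ hs ht => exact fun x y => (hs _ _).trans (ht x y)
  exact transpose_mul_mul_eq_of_isometry fun x y => key _ hX x y

theorem mem_closure_reflectionMap_matrix {K : Type} [Field K] (h2 : (2 : K) ≠ 0)
    {A : Matrix ι ι K} (hA : A.IsSymm) (hd : A.det ≠ 0) {σ : Matrix ι ι K}
    (hσ : σᵀ * A * σ = A) :
    toLin' σ ∈ Submonoid.closure (Set.range (reflectionMap (toBilin' A))) := by
  have := invertibleOfNonzero h2
  have hB := isSymm_toBilin' hA
  obtain ⟨b, hb⟩ := LinearMap.BilinForm.exists_orthogonal_basis (B := toBilin' A) ⟨hB.eq⟩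
  have hnd : (toBilin' A).Nondegenerate := by
    rw [Matrix.nondegenerate_toBilin'_iff]
    exact Matrix.nondegenerate_of_det_ne_zero hd
  refine mem_closure_reflectionMap h2 hB b (fun i j hij => hb hij)
    (hb.not_isOrtho_basis_self_of_separatingLeft hnd.1) fun x y => ?_
  rw [toLin'_apply, toLin'_apply, toBilin'_mulVec, hσ]

theorem toMatrix'_reflectionMap {K : Type} [Field K] (A : Matrix ι ι K) (v : ι → K) (i j : ι) :
    LinearMap.toMatrix' (reflectionMap (toBilin' A) v) i j =
      (1 : Matrix ι ι K) i j - 2 / (v ⬝ᵥ A *ᵥ v) * (v ᵥ* A) j * v i := by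
  rw [LinearMap.toMatrix'_apply, reflectionMap_apply, toBilin'_apply', toBilin'_apply',
    dotProduct_mulVec, dotProduct_mulVec, dotProduct_single]
  simp [one_apply, Pi.single_apply]

variable {p : ℕ} [Fact p.Prime]

theorem map_toMatrix'_reflectionMap (A : Matrix ι ι ℚ) (v : ι → ℚ) :
    (LinearMap.toMatrix' (reflectionMap (toBilin' A) v)).map (Rat.castHom ℚ_[p]) =
      LinearMap.toMatrix'
        (reflectionMap (toBilin' (A.map (Rat.castHom ℚ_[p]))) fun i => (v i : ℚ_[p])) := by
  ext i j
  rw [map_apply, toMatrix'_reflectionMap, toMatrix'_reflectionMap]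
  simp [dotProduct, mulVec, vecMul, one_apply, apply_ite]

theorem exists_approximation {A : Matrix ι ι ℚ} (hA : A.IsSymm) (hd : A.det ≠ 0)
    {σ : Matrix ι ι ℚ_[p]}
    (hσ : σᵀ * A.map (Rat.castHom ℚ_[p]) * σ = A.map (Rat.castHom ℚ_[p]))
    {U : Set (Matrix ι ι ℚ_[p])} (hU : IsOpen U) (hσU : σ ∈ U) :
    ∃ X : Matrix ι ι ℚ, toLin' X ∈ Submonoid.closure (Set.range (reflectionMap (toBilin' A))) ∧
      X.map (Rat.castHom ℚ_[p]) ∈ U := by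
  set A' := A.map (Rat.castHom ℚ_[p]) with hA'
  let G : Submonoid (Matrix ι ι ℚ_[p]) :=
    ((Submonoid.closure (Set.range (reflectionMap (toBilin' A)))).comap
      (toLinAlgEquiv' : Matrix ι ι ℚ ≃ₐ[ℚ] Module.End ℚ (ι → ℚ))).map
        (Rat.castHom ℚ_[p]).mapMatrix
  have hrefl (v : ι → ℚ_[p]) : LinearMap.toMatrix' (reflectionMap (toBilin' A') v) ∈
      G.topologicalClosure := by
    by_cases hv : v ⬝ᵥ A' *ᵥ v = 0
    · have : reflectionMap (toBilin' A') v = 1 := LinearMap.ext fun x => by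
        simp [reflectionMap_apply, toBilin'_apply', hv]
      rw [this, LinearMap.toMatrix'_one]
      exact one_mem _
    have hcont : ContinuousAt (fun w : ι → ℚ_[p] =>
        LinearMap.toMatrix' (reflectionMap (toBilin' A') w)) v := by
      refine continuousAt_pi.2 fun i => continuousAt_pi.2 fun j => ?_
      simp only [toMatrix'_reflectionMap]
      have h1 : ContinuousAt (fun w : ι → ℚ_[p] => w ⬝ᵥ A' *ᵥ w) v := by fun_prop
      have h2 : ContinuousAt (fun w : ι → ℚ_[p] => (w ᵥ* A') j) v := by fun_prop
      have h3 : ContinuousAt (fun w : ι → ℚ_[p] => w i) v := continuousAt_apply i v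
      exact continuousAt_const.sub (((continuousAt_const.div h1 hv).mul h2).mul h3)
    have hdense : DenseRange fun (w : ι → ℚ) i => (w i : ℚ_[p]) :=
      DenseRange.piMap fun _ => Padic.denseRange_ratCast p
    refine closure_mono ?_ (mem_closure_image (f := fun w : ι → ℚ_[p] =>
      LinearMap.toMatrix' (reflectionMap (toBilin' A') w)) hcont (hdense v))
    rintro _ ⟨_, ⟨w, rfl⟩, rfl⟩
    refine ⟨LinearMap.toMatrix' (reflectionMap (toBilin' A) w),
      Submonoid.subset_closure ⟨w, ?_⟩, map_toMatrix'_reflectionMap A w⟩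
    exact (toLin'_toMatrix' _).symm
  have hmem : σ ∈ G.topologicalClosure := by
    have h1 := mem_closure_reflectionMap_matrix two_ne_zero
      (A := A') (by rw [hA', IsSymm, ← transpose_map, hA.eq])
      (by
        have : A'.det = ((A.det : ℚ) : ℚ_[p]) := ((Rat.castHom ℚ_[p]).map_det A).symm
        rw [this]
        exact_mod_cast hd) hσ
    have h2 : Submonoid.closure (Set.range (reflectionMap (toBilin' A'))) ≤
        G.topologicalClosure.comap
          (LinearMap.toMatrixAlgEquiv' : Module.End ℚ_[p] (ι → ℚ_[p]) ≃ₐ[ℚ_[p]] _) := by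
      rw [Submonoid.closure_le]
      rintro _ ⟨v, rfl⟩
      exact hrefl v
    have h3 : LinearMap.toMatrix' (toLin' σ) ∈ G.topologicalClosure := h2 h1
    rwa [LinearMap.toMatrix'_toLin'] at h3
  obtain ⟨_, hYU, X, hX, rfl⟩ := mem_closure_iff.1 hmem U hU hσU
  exact ⟨X, hX, hYU⟩

end Approximation

section LocalToGlobal

open Matrix

variable {ι : Type}

/-- The lattice `ℤ^ι` in `ℚ^ι`. -/
def intLattice (ι : Type) : AddSubgroup (ι → ℚ) := ((Int.castAddHom ℚ).compLeft ι).range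

theorem mem_intLattice {x : ι → ℚ} : x ∈ intLattice ι ↔ ∃ y : ι → ℤ, (fun i => (y i : ℚ)) = x :=
  Iff.rfl

variable [Fintype ι]

theorem prod_den_smul_mem_intLattice (x : ι → ℚ) :
    (∏ i, ((x i).den : ℤ)) • x ∈ intLattice ι := by
  have h (i : ι) : ∃ k : ℤ, (k : ℚ) = ((∏ i, ((x i).den : ℤ) : ℤ) : ℚ) * x i := by
    obtain ⟨c, hc⟩ := Finset.dvd_prod_of_mem (fun i => ((x i).den : ℤ)) (Finset.mem_univ i)
    refine ⟨c * (x i).num, ?_⟩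
    rw [hc]
    push_cast
    rw [← Rat.mul_den_eq_num (x i)]
    ring
  choose y hy using h
  refine mem_intLattice.2 ⟨y, funext fun i => ?_⟩
  rw [hy, Pi.smul_apply, zsmul_eq_mul]

theorem prod_den_ne_zero (x : ι → ℚ) : (∏ i, ((x i).den : ℤ)) ≠ 0 :=
  Finset.prod_ne_zero_iff.2 fun i _ => by exact_mod_cast (x i).den_ne_zero

theorem localizedAt_map {V : Type*} [AddCommGroup V] [Module ℚ V] (p : ℕ) (f : V →ₗ[ℚ] V)
    (L : AddSubgroup V) : localizedAt p (L.map f.toAddMonoidHom) = f '' localizedAt p L := by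
  apply Set.Subset.antisymm
  · rintro x ⟨s, hs, y, hy, hyx⟩
    have hs' : (s : ℚ) ≠ 0 := Int.cast_ne_zero.2 (by rintro rfl; simp at hs)
    refine ⟨(s : ℚ)⁻¹ • y, ⟨s, hs, ?_⟩, ?_⟩
    · rwa [← Int.cast_smul_eq_zsmul ℚ, smul_inv_smul₀ hs']
    · rw [map_smul, inv_smul_eq_iff₀ hs', Int.cast_smul_eq_zsmul]
      exact hyx
  · rintro _ ⟨x, ⟨s, hs, hx⟩, rfl⟩
    exact ⟨s, hs, s • x, hx, map_zsmul f s x⟩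

variable {p : ℕ} [hp : Fact p.Prime]

theorem mem_localizedAt_intLattice {x : ι → ℚ} :
    x ∈ localizedAt p (intLattice ι) ↔ ∀ i, (x i : ℚ_[p]) ∈ PadicInt.subring p := by
  constructor
  · rintro ⟨s, hs, y, hy⟩ i
    have h1 : (s : ℚ_[p]) * (x i : ℚ_[p]) = y i := by
      have := congrFun hy i
      simp only [Pi.smul_apply, zsmul_eq_mul] at this
      exact_mod_cast this.symm
    have h2 : ‖(s : ℚ_[p])‖ = 1 := by
      rw [Padic.norm_intCast_eq_one_iff, isCoprime_comm]
      exact (Nat.prime_iff_prime_int.1 hp.out).coprime_iff_not_dvd.2 hs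
    change ‖(x i : ℚ_[p])‖ ≤ 1
    have h3 : ‖(x i : ℚ_[p])‖ = ‖((y i : ℤ) : ℚ_[p])‖ := by rw [← h1, norm_mul, h2, one_mul]
    exact h3 ▸ Padic.norm_int_le_one (y i)
  · intro h
    refine ⟨_, fun hd => ?_, prod_den_smul_mem_intLattice x⟩
    obtain ⟨i, -, hi⟩ := (Nat.prime_iff_prime_int.1 hp.out).exists_mem_finset_dvd hd
    have hu := PadicInt.isUnit_iff.1 (PadicInt.isUnit_den (p := p) (x i) (h i))
    rw [PadicInt.norm_def, PadicInt.coe_natCast, Padic.norm_natCast_eq_one_iff] at hu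
    exact hp.out.coprime_iff_not_dvd.1 hu (by exact_mod_cast hi)

variable [DecidableEq ι]

theorem isFull_map_intLattice {P Q : Matrix ι ι ℚ} (h : P * Q = 1) :
    IsFull ((intLattice ι).map (toLin' P).toAddMonoidHom) := fun x =>
  ⟨_, prod_den_ne_zero (Q *ᵥ x), _, prod_den_smul_mem_intLattice (Q *ᵥ x), by
    rw [map_zsmul]
    simp [h]⟩

theorem image_localizedAt_intLattice {P Q : Matrix ι ι ℚ} (h : P * Q = 1)
    (hP : ∀ i j, (P i j : ℚ_[p]) ∈ PadicInt.subring p)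
    (hQ : ∀ i j, (Q i j : ℚ_[p]) ∈ PadicInt.subring p) :
    toLin' P '' localizedAt p (intLattice ι) = localizedAt p (intLattice ι) := by
  have key {P : Matrix ι ι ℚ} (hP : ∀ i j, (P i j : ℚ_[p]) ∈ PadicInt.subring p) {x : ι → ℚ}
      (hx : x ∈ localizedAt p (intLattice ι)) : P *ᵥ x ∈ localizedAt p (intLattice ι) := by
    rw [mem_localizedAt_intLattice] at hx ⊢
    intro i
    simp only [mulVec, dotProduct, Rat.cast_sum, Rat.cast_mul]
    exact sum_mem fun j _ => mul_mem (hP i j) (hx j)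
  apply Set.Subset.antisymm
  · rintro _ ⟨x, hx, rfl⟩
    exact key hP hx
  · exact fun x hx => ⟨Q *ᵥ x, key hQ hx, by simp [h]⟩

theorem exists_reflections_image_localizedAt {A R R' A' : Matrix ι ι ℚ} (hA : A.IsSymm)
    (hd : A.det ≠ 0) (hR : R * R' = 1) (hRA : Rᵀ * A * R = A')
    {T T' : Matrix ι ι ℤ_[p]} (hT : T * T' = 1)
    (hTA : (T.map PadicInt.Coe.ringHom)ᵀ * A.map (Rat.castHom ℚ_[p]) * T.map PadicInt.Coe.ringHom =
      A'.map (Rat.castHom ℚ_[p])) :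
    ∃ s ∈ Submonoid.closure (Set.range (reflectionMap (toBilin' A))),
      (s : (ι → ℚ) → ι → ℚ) '' localizedAt p ((intLattice ι).map (toLin' R).toAddMonoidHom) =
        localizedAt p (intLattice ι) := by
  set c := Rat.castHom ℚ_[p] with hc
  set t := T.map PadicInt.Coe.ringHom with ht
  have hR' := mul_eq_one_comm.1 hR
  have hcR : R.map c * R'.map c = 1 := by
    rw [← Matrix.map_mul, hR, Matrix.map_one _ c.map_zero c.map_one]
  have hcR' := mul_eq_one_comm.1 hcR
  have hd' : IsUnit A'.det := by
    rw [isUnit_iff_ne_zero, ← hRA, det_mul, det_mul, det_transpose]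
    have : R.det ≠ 0 := fun h0 => by simpa [h0] using congrArg det hR
    exact mul_ne_zero (mul_ne_zero this hd) this
  have htt : t * T'.map PadicInt.Coe.ringHom = 1 := by
    rw [ht, ← Matrix.map_mul, hT, Matrix.map_one _ (map_zero _) (map_one _)]
  have hσ : (t * R'.map c)ᵀ * A.map c * (t * R'.map c) = A.map c := by
    rw [transpose_mul, show (R'.map c)ᵀ * tᵀ * A.map c * (t * R'.map c) =
      (R'.map c)ᵀ * (tᵀ * A.map c * t) * R'.map c by simp only [mul_assoc], hTA, ← hRA]
    simp only [Matrix.map_mul, transpose_map, ← mul_assoc]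
    rw [← transpose_mul, hcR, transpose_one, one_mul, mul_assoc, hcR, mul_one]
  let U : Set (Matrix ι ι ℚ_[p]) := {X | ∀ i j, (X * R.map c) i j ∈ PadicInt.subring p ∧
    ((A'⁻¹).map c * (X * R.map c)ᵀ * A.map c) i j ∈ PadicInt.subring p}
  have hO : IsOpen (PadicInt.subring p : Set ℚ_[p]) := by
    have := IsUltrametricDist.isOpen_closedBall (0 : ℚ_[p]) one_ne_zero
    rwa [show Metric.closedBall (0 : ℚ_[p]) 1 = PadicInt.subring p from
      Set.ext fun _ => mem_closedBall_zero_iff] at this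
  have hU : IsOpen U := by
    simp only [U, Set.ofPred_forall, Set.ofPred_and]
    refine isOpen_iInter_of_finite fun i => isOpen_iInter_of_finite fun j => IsOpen.inter ?_ ?_
    · refine hO.preimage (f := fun X : Matrix ι ι ℚ_[p] => (X * R.map c) i j) ?_
      exact Continuous.matrix_elem (by fun_prop) i j
    · refine hO.preimage
        (f := fun X : Matrix ι ι ℚ_[p] => ((A'⁻¹).map c * (X * R.map c)ᵀ * A.map c) i j) ?_
      exact Continuous.matrix_elem (by fun_prop) i j
  have hσU : t * R'.map c ∈ U := by
    have h1 : t * R'.map c * R.map c = t := by rw [mul_assoc, hcR', mul_one]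
    have h2 : (A'⁻¹).map c * tᵀ * A.map c = T'.map PadicInt.Coe.ringHom := by
      calc _ = (A'⁻¹).map c * (tᵀ * A.map c * t) * T'.map PadicInt.Coe.ringHom := by
            simp only [mul_assoc, htt, mul_one]
        _ = _ := by
            rw [hTA, ← Matrix.map_mul, nonsing_inv_mul _ hd', Matrix.map_one _ c.map_zero c.map_one,
              one_mul]
    intro i j
    rw [h1, h2]
    exact ⟨(T i j).2, (T' i j).2⟩
  obtain ⟨X, hX, hXU⟩ := exists_approximation hA hd hσ hU hσU
  refine ⟨toLin' X, hX, ?_⟩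
  have hXA := transpose_mul_mul_eq_of_mem_closure hA hX
  have hQ : A'⁻¹ * (X * R)ᵀ * A * (X * R) = 1 := by
    rw [transpose_mul, show A'⁻¹ * (Rᵀ * Xᵀ) * A * (X * R) = A'⁻¹ * (Rᵀ * (Xᵀ * A * X) * R) by
      simp only [mul_assoc], hXA, hRA, nonsing_inv_mul _ hd']
  rw [localizedAt_map, Set.image_image]
  have hcomp : (fun x => toLin' X (toLin' R x)) = toLin' (X * R) := by
    ext x
    simp
  rw [hcomp]
  refine image_localizedAt_intLattice (mul_eq_one_comm.1 hQ) (fun i j => ?_) fun i j => ?_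
  · have := (hXU i j).1
    rwa [← Matrix.map_mul] at this
  · have := (hXU i j).2
    rwa [← Matrix.map_mul, ← transpose_map, ← Matrix.map_mul, ← Matrix.map_mul] at this

theorem stablyIsometric_intLattice {A A' : Matrix ι ι ℤ} {R R' : Matrix ι ι ℚ} (hA : A.IsSymm)
    (hd : A.det ≠ 0) (hR : R * R' = 1)
    (hRA : Rᵀ * A.map (Int.castRingHom ℚ) * R = A'.map (Int.castRingHom ℚ))
    (h : ∀ (p : ℕ) [Fact p.Prime], ∃ T T' : Matrix ι ι ℤ_[p], T * T' = 1 ∧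
      Tᵀ * A.map (Int.castRingHom ℤ_[p]) * T = A'.map (Int.castRingHom ℤ_[p])) :
    StablyIsometric (toBilin' (A.map (Int.castRingHom ℚ)))
      ((intLattice ι).map (toLin' R).toAddMonoidHom) (intLattice ι) := by
  have hAs : (A.map (Int.castRingHom ℚ)).IsSymm := by rw [IsSymm, ← transpose_map, hA.eq]
  have hAd : (A.map (Int.castRingHom ℚ)).det ≠ 0 := by
    have := (Int.castRingHom ℚ).map_det A
    rw [RingHom.mapMatrix_apply] at this
    rw [← this, eq_intCast]
    exact_mod_cast hd
  refine stablyIsometric_of_localizedAt (isSymm_toBilin' hAs)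
    ((∏ i, ∏ j, (R i j).den) * ∏ i, ∏ j, (R' i j).den).primeFactors _ ?_
    (isFull_map_intLattice hR) (fun q hq hqS => ?_) fun p hp => ?_
  · rintro _ ⟨_, ⟨x, rfl⟩, rfl⟩ _ ⟨_, ⟨y, rfl⟩, rfl⟩
    refine ⟨toBilin' A' x y, ?_⟩
    change _ = toBilin' _ (R *ᵥ fun i => (x i : ℚ)) (R *ᵥ fun i => (y i : ℚ))
    rw [toBilin'_mulVec, hRA]
    simp [toBilin'_apply]
  · have := Fact.mk hq
    rw [localizedAt_map]
    have hS : ¬ q ∣ (∏ i, ∏ j, (R i j).den) * ∏ i, ∏ j, (R' i j).den := fun hdvd =>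
      hqS (Nat.mem_primeFactors.2 ⟨hq, hdvd, mul_ne_zero
        (Finset.prod_ne_zero_iff.2 fun i _ => Finset.prod_ne_zero_iff.2 fun j _ => Rat.den_ne_zero _)
        (Finset.prod_ne_zero_iff.2 fun i _ => Finset.prod_ne_zero_iff.2 fun j _ => Rat.den_ne_zero _)⟩)
    have hden (P : Matrix ι ι ℚ) (i j : ι) : (P i j).den ∣ ∏ i, ∏ j, (P i j).den :=
      (Finset.dvd_prod_of_mem (fun j => (P i j).den) (Finset.mem_univ j)).trans
        (Finset.dvd_prod_of_mem (fun i => ∏ j, (P i j).den) (Finset.mem_univ i))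
    exact image_localizedAt_intLattice hR
      (fun i j => Padic.norm_rat_le_one fun hdvd => hS ((hdvd.trans (hden R i j)).mul_right _))
      (fun i j => Padic.norm_rat_le_one fun hdvd => hS ((hdvd.trans (hden R' i j)).mul_left _))
  · have := Fact.mk hp
    obtain ⟨T, T', hT, hTA⟩ := h p
    have hmap (Z : Matrix ι ι ℤ) : (Z.map (Int.castRingHom ℚ)).map (Rat.castHom ℚ_[p]) =
        (Z.map (Int.castRingHom ℤ_[p])).map PadicInt.Coe.ringHom := by
      ext i j
      simp
    refine exists_reflections_image_localizedAt hAs hAd hR hRA hT ?_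
    rw [hmap, hmap, ← transpose_map, ← Matrix.map_mul, ← Matrix.map_mul, hTA]

end LocalToGlobal

section WeakHasse

open Matrix

theorem BilinIsometric.isNeutral {F V W : Type*} [Field F] [AddCommGroup V] [AddCommGroup W]
    [Module F V] [Module F W] [FiniteDimensional F V] [FiniteDimensional F W]
    {B : LinearMap.BilinForm F V} {B' : LinearMap.BilinForm F W} (h : BilinIsometric B B') :
    IsNeutral (orthSum B (-B')) := by
  obtain ⟨e, he⟩ := h
  refine ⟨e.toLinearMap.graph, ?_, ?_⟩
  · rintro ⟨x, x'⟩ hx ⟨y, y'⟩ hy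
    rw [LinearMap.mem_graph_iff] at hx hy
    simp only at hx hy
    subst hx hy
    simp [he]
  · rw [e.toLinearMap.graph_eq_range_prod, LinearMap.finrank_range_of_inj
      (fun x y h => by simpa using congrArg Prod.fst h), Module.finrank_prod, ← e.finrank_eq]
    omega

variable {ι : Type} [Fintype ι] [DecidableEq ι]

theorem bilinIsometric_toBilin'_iff {R : Type*} [CommRing R] {A A' : Matrix ι ι R} :
    BilinIsometric (toBilin' A') (toBilin' A) ↔
      ∃ T T' : Matrix ι ι R, T * T' = 1 ∧ Tᵀ * A * T = A' := by
  constructor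
  · rintro ⟨e, he⟩
    refine ⟨LinearMap.toMatrix' e.toLinearMap, LinearMap.toMatrix' e.symm.toLinearMap, ?_, ?_⟩
    · rw [← LinearMap.toMatrix'_comp]
      simp
    · refine transpose_mul_mul_eq_of_isometry fun x y => ?_
      simpa [LinearMap.toMatrix'_mulVec] using he x y
  · rintro ⟨T, T', h, hT⟩
    refine ⟨toLin'OfInv (mul_eq_one_comm.1 h) h, fun x y => ?_⟩
    rw [← hT, ← toBilin'_mulVec]
    rfl

theorem BilinIsometric.toBilin'_map {R S : Type*} [CommRing R] [CommRing S] (f : R →+* S)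
    {A A' : Matrix ι ι R} (h : BilinIsometric (toBilin' A') (toBilin' A)) :
    BilinIsometric (toBilin' (A'.map f)) (toBilin' (A.map f)) := by
  rw [bilinIsometric_toBilin'_iff] at h ⊢
  obtain ⟨T, T', h, hT⟩ := h
  refine ⟨T.map f, T'.map f, ?_, ?_⟩
  · rw [← Matrix.map_mul, h, Matrix.map_one f f.map_zero f.map_one]
  · rw [← hT, Matrix.map_mul, Matrix.map_mul, transpose_map]

theorem toBilin'_diagonal {K : Type*} [Field K] (a : ι → K) :
    toBilin' (diagonal a) = diagForm a := by
  refine LinearMap.ext₂ fun x y => ?_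
  rw [diagForm_apply, toBilin'_apply']
  simp only [dotProduct, mulVec_diagonal]
  exact Finset.sum_congr rfl fun i _ => by ring

theorem exists_bilinIsometric_diagonal {K : Type} [Field K] (h2 : (2 : K) ≠ 0)
    {A : Matrix ι ι K} (hA : A.IsSymm) (hd : A.det ≠ 0) :
    ∃ a : ι → K, (∀ i, a i ≠ 0) ∧ BilinIsometric (toBilin' (diagonal a)) (toBilin' A) := by
  have := invertibleOfNonzero h2
  have hs := isSymm_toBilin' hA
  obtain ⟨v, hv⟩ := LinearMap.BilinForm.exists_orthogonal_basis (B := toBilin' A) ⟨hs.eq⟩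
  have hn : (toBilin' A).Nondegenerate := by
    rw [Matrix.nondegenerate_toBilin'_iff]
    exact Matrix.nondegenerate_of_det_ne_zero hd
  obtain ⟨σ⟩ : Nonempty (Fin (Module.finrank K (ι → K)) ≃ ι) :=
    ⟨Fintype.equivOfCardEq (by simp)⟩
  set w := v.reindex σ with hw
  have hwo : ∀ i j, i ≠ j → toBilin' A (w i) (w j) = 0 := fun i j hij => by
    simpa [hw] using hv (fun h => hij (σ.symm.injective h))
  have hw0 : ∀ i, toBilin' A (w i) (w i) ≠ 0 := fun i => by
    simpa [hw] using hv.not_isOrtho_basis_self_of_separatingLeft hn.1 (σ.symm i)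
  refine ⟨fun i => toBilin' A (w i) (w i), hw0, w.equivFun.symm, fun x y => ?_⟩
  rw [toBilin'_diagonal, diagForm_apply]
  simp only [Module.Basis.equivFun_symm_apply, map_sum, map_smul, LinearMap.sum_apply,
    LinearMap.smul_apply, smul_eq_mul]
  refine Finset.sum_congr rfl fun i _ => ?_
  rw [Finset.sum_eq_single i (fun j _ hj => by simp [hwo _ _ hj]) (by simp)]
  ring

/-- The weak Hasse principle for isometry of nondegenerate quadratic spaces over `ℚ`. -/
theorem bilinIsometric_of_local {A A' : Matrix ι ι ℚ} (hA : A.IsSymm) (hd : A.det ≠ 0)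
    (hA' : A'.IsSymm) (hd' : A'.det ≠ 0)
    (hR : BilinIsometric (toBilin' (A'.map (algebraMap ℚ ℝ))) (toBilin' (A.map (algebraMap ℚ ℝ))))
    (hp : ∀ (p : ℕ) [Fact p.Prime], BilinIsometric (toBilin' (A'.map (algebraMap ℚ ℚ_[p])))
      (toBilin' (A.map (algebraMap ℚ ℚ_[p])))) :
    BilinIsometric (toBilin' A') (toBilin' A) := by
  obtain ⟨a, ha, hAa⟩ := exists_bilinIsometric_diagonal two_ne_zero hA hd
  obtain ⟨b, hb, hAb⟩ := exists_bilinIsometric_diagonal two_ne_zero hA' hd'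
  have hneg {K : Type} [Field K] (c : ι → K) : -diagForm c = diagForm (-c) := by
    refine LinearMap.ext₂ fun x y => ?_
    simp [diagForm_apply, Finset.sum_neg_distrib]
  have hne : ∀ i, Sum.elim b (-a) i ≠ 0 := by
    rintro (i | i)
    · exact hb i
    · exact neg_ne_zero.2 (ha i)
  have hloc {K : Type} [Field K] (f : ℚ →+* K)
      (h : BilinIsometric (toBilin' (A'.map f)) (toBilin' (A.map f))) :
      wittMap f (∑ i, wittClass (Sum.elim b (-a) i)) = 0 := by
    have h' := ((hAb.toBilin'_map f).trans h).trans (hAa.toBilin'_map f).symm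
    rw [diagonal_map f.map_zero, diagonal_map f.map_zero, toBilin'_diagonal,
      toBilin'_diagonal] at h'
    have h'' := h'.isNeutral
    rw [hneg, ← isNeutral_diagForm_sumElim] at h''
    rw [map_sum]
    simp only [wittMap_wittClass]
    rw [sum_wittClass_eq_zero_iff fun i => (map_ne_zero f).2 (hne i)]
    convert h'' using 2
    ext (i | i) <;> simp
  have hx := eq_zero_of_forall_wittMap_eq_zero (hloc _ hR) fun p _ => hloc _ (hp p)
  rw [sum_wittClass_eq_zero_iff hne, isNeutral_diagForm_sumElim, ← hneg] at hx
  have hba := exists_isometry_of_isNeutral two_ne_zero (Fintype.card ι) (diagForm_isSymm b)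
    (diagForm_isSymm a) (diagForm_nondegenerate b hb) (diagForm_nondegenerate a ha)
    (by simp) (by simp) hx
  rw [← toBilin'_diagonal, ← toBilin'_diagonal] at hba
  exact (hAb.symm.trans hba).trans hAa

end WeakHasse

section StableIsometry

open Matrix

theorem hypSum_eq_zero_of_forall {V : Type*} [AddCommGroup V] [Module ℚ V]
    {β : LinearMap.BilinForm ℚ V} (hβ : β.Nondegenerate) {x : ℚ × ℚ × V}
    (h : ∀ y, hypSum β x y = 0) : x = 0 := by
  obtain ⟨a, b, v⟩ := x
  have h1 : a = 0 := by simpa [hypSum] using h (0, 1, 0)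
  have h2 : b = 0 := by simpa [hypSum] using h (1, 0, 0)
  have h3 : v = 0 := hβ.1 v fun w => by simpa [hypSum] using h (0, 0, w)
  simp [h1, h2, h3]

theorem BilinIsometric.prodForm_hypU {M N : Type*} [AddCommGroup M] [AddCommGroup N] [Module ℤ M]
    [Module ℤ N] {B : LinearMap.BilinForm ℤ M} {C : LinearMap.BilinForm ℤ N}
    (h : BilinIsometric B C) : BilinIsometric (prodForm hypU B) (prodForm hypU C) := by
  obtain ⟨e, he⟩ := h
  exact ⟨((AddEquiv.refl (ℤ × ℤ)).prodCongr e.toAddEquiv).toIntLinearEquiv, fun x y =>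
    congrArg (hypU x.1 y.1 + ·) (he x.2 y.2)⟩

variable {ι : Type} [Fintype ι]

/-- The embedding of `ℤ² × ℤⁿ` in `ℚ × ℚ × ℚⁿ` acting by the matrix `R` on the last factor. -/
def hypEmbedding (R : Matrix ι ι ℚ) : (ℤ × ℤ) × (ι → ℤ) →+ ℚ × ℚ × (ι → ℚ) where
  toFun x := (x.1.1, x.1.2, R *ᵥ fun i => (x.2 i : ℚ))
  map_zero' := by
    have : (fun _ : ι => (0 : ℚ)) = 0 := rfl
    simp [this]
  map_add' x y := by
    have : (fun i => ((x.2 i : ℚ) + y.2 i)) = (fun i => (x.2 i : ℚ)) + fun i => (y.2 i : ℚ) := rfl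
    simp [this, mulVec_add]

theorem hypEmbedding_apply (R : Matrix ι ι ℚ) (x : (ℤ × ℤ) × (ι → ℤ)) :
    hypEmbedding R x = ((x.1.1 : ℚ), (x.1.2 : ℚ), R *ᵥ fun i => (x.2 i : ℚ)) := rfl

variable [DecidableEq ι]

theorem hypEmbedding_injective {R R' : Matrix ι ι ℚ} (h : R * R' = 1) :
    Function.Injective (hypEmbedding R) := by
  rintro ⟨⟨a, b⟩, u⟩ ⟨⟨c, d⟩, v⟩ huv
  simp only [hypEmbedding_apply, Prod.mk.injEq, Int.cast_inj] at huv
  obtain ⟨rfl, rfl, huv⟩ := huv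
  have key := congrArg (R' *ᵥ ·) huv
  simp only [mulVec_mulVec, mul_eq_one_comm.1 h, one_mulVec] at key
  congr 1
  exact funext fun i => by simpa using congrFun key i

theorem range_hypEmbedding (R : Matrix ι ι ℚ) : (hypEmbedding R).range =
    hypLattice ((intLattice ι).map (toLin' R).toAddMonoidHom) := by
  ext ⟨a, b, v⟩
  constructor
  · rintro ⟨⟨⟨c, d⟩, u⟩, hu⟩
    rw [hypEmbedding_apply] at hu
    simp only [Prod.mk.injEq] at hu
    obtain ⟨rfl, rfl, rfl⟩ := hu
    exact ⟨⟨c, rfl⟩, ⟨d, rfl⟩, _, mem_intLattice.2 ⟨u, rfl⟩, rfl⟩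
  · rintro ⟨⟨c, rfl⟩, ⟨d, rfl⟩, _, ⟨u, rfl⟩, hv⟩
    exact ⟨((c, d), u), by rw [hypEmbedding_apply]; exact congrArg _ (congrArg _ hv)⟩

theorem hypSum_hypEmbedding {A A' : Matrix ι ι ℤ} {R : Matrix ι ι ℚ}
    (hRA : Rᵀ * A.map (Int.castRingHom ℚ) * R = A'.map (Int.castRingHom ℚ))
    (x y : (ℤ × ℤ) × (ι → ℤ)) :
    hypSum (toBilin' (A.map (Int.castRingHom ℚ))) (hypEmbedding R x) (hypEmbedding R y) =
      (prodForm hypU (toBilin' A') x y : ℤ) := by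
  simp only [hypSum, hypEmbedding_apply, toBilin'_mulVec, hRA]
  simp [prodForm, hypU, toBilin'_apply]

theorem StablyIsometric.bilinIsometric {A A' : Matrix ι ι ℤ} {R R' : Matrix ι ι ℚ}
    (hd : A.det ≠ 0) (hR : R * R' = 1)
    (hRA : Rᵀ * A.map (Int.castRingHom ℚ) * R = A'.map (Int.castRingHom ℚ))
    (h : StablyIsometric (toBilin' (A.map (Int.castRingHom ℚ)))
      ((intLattice ι).map (toLin' R).toAddMonoidHom) (intLattice ι)) :
    BilinIsometric (prodForm hypU (toBilin' A')) (prodForm hypU (toBilin' A)) := by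
  obtain ⟨Ψ, hΨ, hmap⟩ := h
  have hn : (toBilin' (A.map (Int.castRingHom ℚ))).Nondegenerate := by
    rw [nondegenerate_toBilin'_iff]
    refine nondegenerate_of_det_ne_zero ?_
    rw [← RingHom.mapMatrix_apply, ← RingHom.map_det]
    simpa using hd
  have hinj : Function.Injective Ψ := (injective_iff_map_eq_zero Ψ).2 fun x hx =>
    hypSum_eq_zero_of_forall hn fun y => by rw [← hΨ, hx]; simp [hypSum]
  have h1 : (hypEmbedding (1 : Matrix ι ι ℚ)).range = hypLattice (intLattice ι) := by
    rw [range_hypEmbedding]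
    congr 1
    ext x
    simp
  have hrange : (Ψ.comp (hypEmbedding R)).range = (hypEmbedding (1 : Matrix ι ι ℚ)).range := by
    rw [h1, ← hmap, ← range_hypEmbedding, AddMonoidHom.map_range]
  let e := (AddMonoidHom.ofInjective (f := Ψ.comp (hypEmbedding R))
    (hinj.comp (hypEmbedding_injective hR))).trans ((AddEquiv.addSubgroupCongr hrange).trans
    (AddMonoidHom.ofInjective (hypEmbedding_injective (one_mul (1 : Matrix ι ι ℚ)))).symm)
  have he (x) : hypEmbedding 1 (e x) = Ψ (hypEmbedding R x) :=
    congrArg Subtype.val ((AddMonoidHom.ofInjective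
      (hypEmbedding_injective (one_mul (1 : Matrix ι ι ℚ)))).apply_symm_apply _)
  refine ⟨e.toIntLinearEquiv, fun x y => ?_⟩
  have key := hΨ (hypEmbedding R x) (hypEmbedding R y)
  rw [← he, ← he, hypSum_hypEmbedding hRA, hypSum_hypEmbedding (A' := A) (by simp)] at key
  exact_mod_cast key

end StableIsometry

section Genus

open Matrix

variable {ι : Type} [Fintype ι] [DecidableEq ι]

theorem bilinIsometric_toMatrix {S P : Type*} [CommRing S] [AddCommGroup P] [Module S P]
    (b : Module.Basis ι S P) (B : LinearMap.BilinForm S P) :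
    BilinIsometric B (toBilin' (LinearMap.BilinForm.toMatrix b B)) :=
  ⟨b.equivFun, fun x y => by
    rw [toBilin'_apply', LinearMap.BilinForm.dotProduct_toMatrix_mulVec,
      LinearEquiv.symm_apply_apply, LinearEquiv.symm_apply_apply]⟩

theorem bilinIsometric_toMatrix_map {S P : Type*} [CommRing S] [AddCommGroup P] [Module ℤ P]
    (b : Module.Basis ι ℤ P) (B : LinearMap.BilinForm ℤ P) : BilinIsometric (B.baseChange S)
      (toBilin' ((LinearMap.BilinForm.toMatrix b B).map (Int.castRingHom S))) := by
  convert bilinIsometric_toMatrix (b.baseChange S) (B.baseChange S) using 2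
  ext i j
  simp [LinearMap.BilinForm.toMatrix_apply]

theorem SameGenus.bilinIsometric_prodForm_hypU {M N : Type*} [AddCommGroup M] [AddCommGroup N]
    [Module ℤ M] [Module ℤ N] [Module.Free ℤ M] [Module.Finite ℤ M] [Module.Free ℤ N]
    [Module.Finite ℤ N] {B : LinearMap.BilinForm ℤ M} {B' : LinearMap.BilinForm ℤ N}
    (hn : B.Nondegenerate) (hn' : B'.Nondegenerate) (hB : B.IsSymm) (hB' : B'.IsSymm)
    (h : SameGenus B B') : BilinIsometric (prodForm hypU B) (prodForm hypU B') := by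
  obtain ⟨hR, hp⟩ := h
  have hrank : Module.finrank ℤ M = Module.finrank ℤ N := by
    obtain ⟨e, -⟩ := hR
    simpa using e.finrank_eq
  let b := Module.finBasisOfFinrankEq ℤ M hrank
  let b' := Module.finBasis ℤ N
  have hloc {S : Type} [CommRing S] (h : BilinIsometric (B.baseChange S) (B'.baseChange S)) :
      BilinIsometric (toBilin' ((LinearMap.BilinForm.toMatrix b B).map (Int.castRingHom S)))
        (toBilin' ((LinearMap.BilinForm.toMatrix b' B').map (Int.castRingHom S))) :=
    ((bilinIsometric_toMatrix_map b B).symm.trans h).trans (bilinIsometric_toMatrix_map b' B')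
  have hd := (LinearMap.BilinForm.nondegenerate_iff_det_ne_zero b).1 hn
  have hd' := (LinearMap.BilinForm.nondegenerate_iff_det_ne_zero b').1 hn'
  have hs : (LinearMap.BilinForm.toMatrix b B).IsSymm := Matrix.IsSymm.ext fun i j => by
    simp only [LinearMap.BilinForm.toMatrix_apply, hB.eq]
  have hs' : (LinearMap.BilinForm.toMatrix b' B').IsSymm := Matrix.IsSymm.ext fun i j => by
    simp only [LinearMap.BilinForm.toMatrix_apply, hB'.eq]
  refine ((bilinIsometric_toMatrix b B).prodForm_hypU.trans ?_).trans
    (bilinIsometric_toMatrix b' B').prodForm_hypU.symm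
  replace hR := hloc hR
  replace hp := fun (p : ℕ) [Fact p.Prime] => hloc (hp p)
  clear hloc
  generalize LinearMap.BilinForm.toMatrix b B = A' at *
  generalize LinearMap.BilinForm.toMatrix b' B' = A at *
  have hdet {A : Matrix (Fin (Module.finrank ℤ N)) (Fin (Module.finrank ℤ N)) ℤ} (h : A.det ≠ 0) :
      (A.map (Int.castRingHom ℚ)).det ≠ 0 := by
    rw [← RingHom.mapMatrix_apply, ← RingHom.map_det]
    simpa using h
  have hmap {S T : Type} [CommRing S] [CommRing T] (f : S →+* T)
      (A : Matrix (Fin (Module.finrank ℤ N)) (Fin (Module.finrank ℤ N)) ℤ) :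
      (A.map (Int.castRingHom S)).map f = A.map (Int.castRingHom T) := by
    ext i j
    simp
  obtain ⟨R, R', hRR, hRA⟩ := bilinIsometric_toBilin'_iff.1 <| bilinIsometric_of_local
    (hs'.map (Int.castRingHom ℚ)) (hdet hd') (hs.map (Int.castRingHom ℚ)) (hdet hd)
    (by simpa only [hmap] using hR) fun p _ => by
      simpa only [hmap] using (hp p).toBilin'_map PadicInt.Coe.ringHom
  exact (stablyIsometric_intLattice hs' hd' hRR hRA fun p _ =>
    bilinIsometric_toBilin'_iff.1 (hp p)).bilinIsometric hd' hRR hRA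

end Genus

/-- two ℤ-lattices `L, L'` lie in the same genus if and only if
`U ⊕ L` and `U ⊕ L'` are isometric, where `U` is the hyperbolic plane. -/
theorem sameGenus_iff_hyperbolic_stable_isometric
    {M N : Type*} [AddCommGroup M] [AddCommGroup N] [Module ℤ M] [Module ℤ N]
    [Module.Free ℤ M] [Module.Finite ℤ M] [Module.Free ℤ N] [Module.Finite ℤ N]
    (B : LinearMap.BilinForm ℤ M) (B' : LinearMap.BilinForm ℤ N)
    (hBnd : B.Nondegenerate) (hB'nd : B'.Nondegenerate)
    (hBsymm : B.IsSymm) (hB'symm : B'.IsSymm) :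
    SameGenus B B' ↔ BilinIsometric (prodForm hypU B) (prodForm hypU B') := by
  refine ⟨SameGenus.bilinIsometric_prodForm_hypU hBnd hB'nd hBsymm hB'symm, fun h => ?_⟩
  obtain rfl : ‹Module ℤ M› = AddCommGroup.toIntModule M := Subsingleton.elim _ _
  obtain rfl : ‹Module ℤ N› = AddCommGroup.toIntModule N := Subsingleton.elim _ _
  exact sameGenus_of_prodForm_hypU hB'symm h
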